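/- Let n ≥ 3 and 0 ≤ i ≤ n. The i-th rational Betti number of the small cover X(P₆ × I^{n−2}, χ'') is β_i = 3·C(n−2, i−1) + C(n−2, i) if i is even, and β_i = 3·C(n−2, i−1) + C(n−2, i−2) if i is odd. -/

import Mathlib

open Complex CategoryTheory

/-- The vertices of a convex hexagon `P₆ ⊂ ℝ² = ℂ` (the 6th roots of unity), in cyclic
order; `hexVertex 6 = hexVertex 0`. -/
noncomputable def hexVertex (k : ℕ) : ℂ :=
  Complex.exp (2 * Real.pi * Complex.I * k / 6)

/-- The convex hexagon `P₆ ⊂ ℝ² = ℂ`, with edges `[hexVertex k, hexVertex (k+1)]` in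
cyclic order. -/
noncomputable def Hexagon : Set ℂ :=
  convexHull ℝ (Set.range fun k : Fin 6 => hexVertex k)

/-- Points of the `n`-dimensional simple polytope `P = P₆ × [−1,1]^{n−2}`. -/
abbrev HexPrismPt (n : ℕ) : Type :=
  Hexagon × (Fin (n - 2) → (Set.Icc (-1 : ℝ) 1))

/-- The standard basis vector `e_{k+1}` of `𝔽₂ⁿ` (indexed from `0`). -/
def eVec (n k : ℕ) : Fin n → ZMod 2 := fun i => if (i : ℕ) = k then 1 else 0

/-- The values of `χ''` on the six hexagon-edge facets, in cyclic order of the edges: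
`e₁+⋯+e_n, e_{n−1}, e_n, e₁+⋯+e_n, e_{n−1}, e_n`. -/
def hexEdgeVal (n : ℕ) : Fin 6 → (Fin n → ZMod 2) :=
  ![fun _ => 1, eVec n (n - 2), eVec n (n - 1), fun _ => 1, eVec n (n - 2), eVec n (n - 1)]

/-- The set of values `χ''(F)` over all facets `F` of `P₆ × I^{n−2}` containing the point
`p`: the cube facet in the `i`-th cube coordinate (value `e_i`) and the hexagon-edge
facets (values `hexEdgeVal`). -/
noncomputable def hexGenSet (n : ℕ) (p : HexPrismPt n) : Set (Fin n → ZMod 2) :=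
  {v | (∃ i : Fin (n - 2), ((p.2 i : ℝ) = -1 ∨ (p.2 i : ℝ) = 1) ∧ v = eVec n (i : ℕ)) ∨
       (∃ k : Fin 6, (p.1 : ℂ) ∈ segment ℝ (hexVertex (k : ℕ)) (hexVertex ((k : ℕ) + 1)) ∧
          v = hexEdgeVal n k)}

/-- The small cover relation on `𝔽₂ⁿ × (P₆ × I^{n−2})`: `(t,p) ~ (u,q)` iff `p = q` and
`t + u` lies in the subgroup of `𝔽₂ⁿ` generated by the `χ''`-values of the facets
containing `p`. -/
noncomputable def hexCoverRel (n : ℕ)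
    (x y : (Fin n → ZMod 2) × HexPrismPt n) : Prop :=
  x.2 = y.2 ∧ x.1 + y.1 ∈ Submodule.span (ZMod 2) (hexGenSet n x.2)

/-- The small cover `X(P₆ × I^{n−2}, χ'')`. -/
noncomputable def HexCover (n : ℕ) : Type := Quot (hexCoverRel n)

noncomputable instance (n : ℕ) : TopologicalSpace (HexCover n) := by
  unfold HexCover; infer_instance

/-- The `i`-th singular homology of a topological space with rational coefficients. -/
noncomputable def singularHomologyQ (X : TopCat.{0}) (i : ℕ) : ModuleCat.{0} ℚ :=
  ((AlgebraicTopology.alternatingFaceMapComplex (ModuleCat.{0} ℚ)).obj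
    (((SimplicialObject.whiskering _ _).obj (ModuleCat.free ℚ)).obj
      (TopCat.toSSet.obj X))).homology i

/-- The `i`-th rational Betti number `β_i(X; ℚ)`, as a cardinal. -/
noncomputable def rationalBetti (X : TopCat.{0}) (i : ℕ) : Cardinal :=
  Module.rank ℚ (singularHomologyQ X i)

/-- Binomial coefficient `C(a, b)` with an integer lower argument (zero when `b < 0`). -/
def chooseInt (a : ℕ) (b : ℤ) : ℕ := if 0 ≤ b then a.choose b.toNat else 0


namespace HC

/-! ### Part 0: abstract homological algebra with a square-zero endomorphism -/

section Abs
variable {M : Type*} [AddCommGroup M] [Module ℚ M]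

/-- vanishing of the relative homology of `A ≤ B` -/
def Rel (D : M →ₗ[ℚ] M) (A B : Submodule ℚ M) : Prop :=
  ∀ b ∈ B, D b ∈ A → ∃ a ∈ A, ∃ c ∈ B, b = a + D c

def Sph (D : M →ₗ[ℚ] M) (A : Submodule ℚ M) (z : M) : Prop :=
  z ∈ A ∧ D z = 0 ∧ (∀ a ∈ A, D a = 0 → ∃ q : ℚ, ∃ c ∈ A, a = q • z + D c) ∧
    (∀ q : ℚ, ∀ c ∈ A, q • z = D c → q = 0)

variable {D : M →ₗ[ℚ] M}

lemma Rel.union (hD : ∀ x, D (D x) = 0) {A1 A2 B1 B2 : Submodule ℚ M}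
    (hA1 : ∀ a ∈ A1, D a ∈ A1) (hA2 : ∀ a ∈ A2, D a ∈ A2)
    (hB1 : ∀ a ∈ B1, D a ∈ B1) (hB2 : ∀ a ∈ B2, D a ∈ B2)
    (l1 : A1 ≤ B1) (l2 : A2 ≤ B2)
    (h1 : Rel D A1 B1) (h2 : Rel D A2 B2) (h12 : Rel D (A1 ⊓ A2) (B1 ⊓ B2)) :
    Rel D (A1 ⊔ A2) (B1 ⊔ B2) := by
  intro b hb hdb
  obtain ⟨b1, hb1, b2, hb2, rfl⟩ := Submodule.mem_sup.1 hb
  obtain ⟨a1, ha1, a2, ha2, e⟩ := Submodule.mem_sup.1 hdb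
  rw [map_add] at e
  have e' : D b1 - a1 = a2 - D b2 := by rw [sub_eq_sub_iff_add_eq_add, add_comm a2, e]
  have hE : D b1 - a1 ∈ B1 ⊓ B2 := by
    refine ⟨B1.sub_mem (hB1 _ hb1) (l1 ha1), ?_⟩
    rw [e']; exact B2.sub_mem (l2 ha2) (hB2 _ hb2)
  have hdE : D (D b1 - a1) ∈ A1 ⊓ A2 := by
    constructor
    · rw [map_sub, hD, zero_sub]; exact A1.neg_mem (hA1 _ ha1)
    · rw [e', map_sub, hD, sub_zero]; exact hA2 _ ha2
  obtain ⟨a, ha, c, hc, hac⟩ := h12 _ hE hdE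
  obtain ⟨x1, hx1, y1, hy1, r1⟩ := h1 (b1 - c) (B1.sub_mem hb1 hc.1) (by
    have : D (b1 - c) = a1 + a := by
      rw [map_sub, sub_eq_iff_eq_add, add_assoc, ← hac]; abel
    rw [this]; exact A1.add_mem ha1 ha.1)
  obtain ⟨x2, hx2, y2, hy2, r2⟩ := h2 (b2 + c) (B2.add_mem hb2 hc.2) (by
    have : D (b2 + c) = a2 - a := by
      rw [map_add, eq_sub_iff_add_eq, add_assoc, add_comm (D c), ← hac, e']; abel
    rw [this]; exact A2.sub_mem ha2 ha.2)
  refine ⟨x1 + x2, Submodule.add_mem_sup hx1 hx2, y1 + y2, Submodule.add_mem_sup hy1 hy2, ?_⟩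
  have : b1 + b2 = (b1 - c) + (b2 + c) := by abel
  rw [this, r1, r2, map_add]; abel

lemma Rel.trans {A B C : Submodule ℚ M} (hAB : A ≤ B) (hBC : B ≤ C)
    (hD : ∀ x, D (D x) = 0)
    (h1 : Rel D A B) (h2 : Rel D B C) : Rel D A C := by
  intro z hz hdz
  obtain ⟨y, hy, c, hc, rfl⟩ := h2 z hz (hAB hdz)
  rw [map_add, hD, add_zero] at hdz
  obtain ⟨a, ha, c', hc', rfl⟩ := h1 y hy hdz
  exact ⟨a, ha, c' + c, C.add_mem (hBC hc') hc, by rw [map_add]; abel⟩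

lemma Rel.cancel {A B C : Submodule ℚ M} (hAB : A ≤ B) (hBC : B ≤ C)
    (hD : ∀ x, D (D x) = 0)
    (h1 : Rel D A B) (h2 : Rel D A C) : Rel D B C := by
  intro z hz hdz
  obtain ⟨x, hx, y, hy, e⟩ := h1 _ hdz (by rw [hD]; exact A.zero_mem)
  obtain ⟨x', hx', c, hc, e'⟩ := h2 (z - y) (C.sub_mem hz (hBC hy)) (by
    rw [map_sub, e]; simpa using hx)
  exact ⟨x' + y, B.add_mem (hAB hx') hy, c, hc, by
    rw [sub_eq_iff_eq_add] at e'; rw [e']; abel⟩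

/-- relative vanishing for unions, with the unions only "generated" up to relative vanishing -/
lemma Rel.union' (hD : ∀ x, D (D x) = 0) {A1 A2 B1 B2 A B : Submodule ℚ M}
    (hA1 : ∀ a ∈ A1, D a ∈ A1) (hA2 : ∀ a ∈ A2, D a ∈ A2)
    (hB1 : ∀ a ∈ B1, D a ∈ B1) (hB2 : ∀ a ∈ B2, D a ∈ B2)
    (l1 : A1 ≤ B1) (l2 : A2 ≤ B2) (hAB : A ≤ B) (hA : A1 ⊔ A2 ≤ A) (hB : B1 ⊔ B2 ≤ B)
    (rA : Rel D (A1 ⊔ A2) A) (rB : Rel D (B1 ⊔ B2) B)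
    (h1 : Rel D A1 B1) (h2 : Rel D A2 B2) (h12 : Rel D (A1 ⊓ A2) (B1 ⊓ B2)) :
    Rel D A B :=
  Rel.cancel hA hAB hD rA
    (Rel.trans (sup_le_sup l1 l2) hB hD (Rel.union hD hA1 hA2 hB1 hB2 l1 l2 h1 h2 h12) rB)

lemma Rel.bot_of (hD : ∀ x, D (D x) = 0) {B : Submodule ℚ M}
    (h : ∀ b ∈ B, D b = 0 → ∃ c ∈ B, b = D c) : Rel D ⊥ B := by
  intro b hb hdb
  obtain ⟨c, hc, e⟩ := h b hb (by simpa using hdb)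
  exact ⟨0, Submodule.zero_mem _, c, hc, by rw [zero_add]; exact e⟩

lemma Rel.of_bot {B : Submodule ℚ M} (h : Rel D ⊥ B) :
    ∀ b ∈ B, D b = 0 → ∃ c ∈ B, b = D c := by
  intro b hb hdb
  obtain ⟨a, ha, c, hc, e⟩ := h b hb (by simpa using hdb)
  rw [Submodule.mem_bot] at ha
  exact ⟨c, hc, by rw [e, ha, zero_add]⟩

lemma Rel.of_acyclic (hD : ∀ x, D (D x) = 0) {A B : Submodule ℚ M} (hAB : A ≤ B)
    (hA : Rel D ⊥ A) (hB : Rel D ⊥ B) : Rel D A B :=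
  Rel.cancel bot_le hAB hD hA hB

lemma Rel.of_sph (hD : ∀ x, D (D x) = 0) {A B : Submodule ℚ M} {z : M} (hAB : A ≤ B)
    (hA : Sph D A z) (hB : Sph D B z) : Rel D A B := by
  intro b hb hdb
  obtain ⟨q, c, hc, e⟩ := hA.2.2.1 (D b) hdb (hD b)
  have hq : q = 0 := hB.2.2.2 q (b - c) (B.sub_mem hb (hAB hc)) (by
    rw [map_sub, e]; abel)
  rw [hq, zero_smul, zero_add] at e
  obtain ⟨q', c', hc', e'⟩ := hB.2.2.1 (b - c) (B.sub_mem hb (hAB hc)) (by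
    rw [map_sub, e, sub_self])
  exact ⟨q' • z + c, A.add_mem (A.smul_mem _ hA.1) hc, c', hc', by
    rw [sub_eq_iff_eq_add] at e'; rw [e']; abel⟩

lemma Sph.of_rel (hD : ∀ x, D (D x) = 0) {A B : Submodule ℚ M} {z : M} (hAB : A ≤ B)
    (hA : Sph D A z) (h : Rel D A B) : Sph D B z := by
  refine ⟨hAB hA.1, hA.2.1, ?_, ?_⟩
  · intro b hb hdb
    obtain ⟨a, ha, c, hc, rfl⟩ := h b hb (by rw [hdb]; exact A.zero_mem)
    rw [map_add, hD, add_zero] at hdb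
    obtain ⟨q, c', hc', e⟩ := hA.2.2.1 a ha hdb
    exact ⟨q, c' + c, B.add_mem (hAB hc') hc, by rw [e, map_add]; abel⟩
  · intro q c hc e
    obtain ⟨a, ha, c', hc', rfl⟩ := h c hc (by rw [← e]; exact A.smul_mem _ hA.1)
    rw [map_add, hD, add_zero] at e
    exact hA.2.2.2 q a ha e

lemma Sph.union (hD : ∀ x, D (D x) = 0) {A1 A2 : Submodule ℚ M} {z c1 c2 : M}
    (hA1 : ∀ a ∈ A1, D a ∈ A1) (hA2 : ∀ a ∈ A2, D a ∈ A2)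
    (h1 : Rel D ⊥ A1) (h2 : Rel D ⊥ A2) (h : Sph D (A1 ⊓ A2) z)
    (hc1 : c1 ∈ A1) (hc2 : c2 ∈ A2) (e1 : D c1 = z) (e2 : D c2 = z) :
    Sph D (A1 ⊔ A2) (c1 - c2) := by
  refine ⟨?_, by rw [map_sub, e1, e2, sub_self], ?_, ?_⟩
  · rw [sub_eq_add_neg]; exact Submodule.add_mem_sup hc1 (A2.neg_mem hc2)
  · intro a ha hda
    obtain ⟨a1, ha1, a2, ha2, rfl⟩ := Submodule.mem_sup.1 ha
    rw [map_add] at hda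
    have hd : D a1 = - D a2 := eq_neg_of_add_eq_zero_left hda
    obtain ⟨q, c, hc, e⟩ := h.2.2.1 (D a1) ⟨hA1 _ ha1, by
      rw [hd]; exact A2.neg_mem (hA2 _ ha2)⟩ (hD _)
    obtain ⟨f1, hf1, r1⟩ := h1.of_bot (a1 - q • c1 - c)
      (A1.sub_mem (A1.sub_mem ha1 (A1.smul_mem _ hc1)) hc.1) (by
        rw [map_sub, map_sub, map_smul, e1, e]; abel)
    obtain ⟨f2, hf2, r2⟩ := h2.of_bot (a2 + q • c2 + c)
      (A2.add_mem (A2.add_mem ha2 (A2.smul_mem _ hc2)) hc.2) (by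
        rw [map_add, map_add, map_smul, e2, add_assoc, ← e, hd]; abel)
    refine ⟨q, f1 + f2, Submodule.add_mem_sup hf1 hf2, ?_⟩
    rw [map_add, ← r1, ← r2, smul_sub]; abel
  · intro q c hc e
    obtain ⟨f1, hf1, f2, hf2, rfl⟩ := Submodule.mem_sup.1 hc
    rw [map_add, smul_sub] at e
    have e' : q • c1 - D f1 = q • c2 + D f2 := by
      rw [sub_eq_iff_eq_add, add_assoc, add_comm (D f2), ← e]; abel
    refine h.2.2.2 q (q • c1 - D f1) ⟨A1.sub_mem (A1.smul_mem _ hc1) (hA1 _ hf1), ?_⟩ ?_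
    · rw [e']; exact A2.add_mem (A2.smul_mem _ hc2) (hA2 _ hf2)
    · rw [map_sub, map_smul, hD, e1, sub_zero]

end Abs
end HC


namespace HC

/-! ### Part 1: linear chains -/
section Lin

/-- linear chains with `n` vertices -/
abbrev LC (E : Type*) (n : ℕ) := (Fin n → E) →₀ ℚ

variable {E F : Type*}

noncomputable def bd (n : ℕ) : LC E (n + 1) →ₗ[ℚ] LC E n :=
  Finsupp.lsum ℚ fun v => LinearMap.toSpanSingleton ℚ _
    (∑ i : Fin (n + 1), (-1 : ℚ) ^ (i : ℕ) • Finsupp.single (v ∘ i.succAbove) 1)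

noncomputable def cone (b : E) (n : ℕ) : LC E n →ₗ[ℚ] LC E (n + 1) :=
  Finsupp.lmapDomain ℚ ℚ (fun v => (Fin.cons b v : Fin (n + 1) → E))

noncomputable def push (f : E → F) (n : ℕ) : LC E n →ₗ[ℚ] LC F n :=
  Finsupp.lmapDomain ℚ ℚ (fun v => f ∘ v)

@[simp] lemma bd_single (n : ℕ) (v : Fin (n + 1) → E) :
    bd n (Finsupp.single v 1) =
      ∑ i : Fin (n + 1), (-1 : ℚ) ^ (i : ℕ) • Finsupp.single (v ∘ i.succAbove) 1 := by
  simp [bd]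

@[simp] lemma cone_single (b : E) (n : ℕ) (v : Fin n → E) :
    cone b n (Finsupp.single v 1) = Finsupp.single (Fin.cons b v) 1 := by
  simp [cone]

@[simp] lemma push_single (f : E → F) (n : ℕ) (v : Fin n → E) :
    push f n (Finsupp.single v 1) = Finsupp.single (f ∘ v) 1 := by
  simp [push]

lemma lc_ext {n : ℕ} {N : Type*} [AddCommGroup N] [Module ℚ N] {f g : LC E n →ₗ[ℚ] N}
    (h : ∀ v, f (Finsupp.single v 1) = g (Finsupp.single v 1)) (x : LC E n) : f x = g x := by
  have : f = g := by
    apply Finsupp.lhom_ext'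
    intro v
    apply LinearMap.ext_ring
    exact h v
  rw [this]

lemma bd_cone_zero (b : E) (x : LC E 0) : bd 0 (cone b 0 x) = x := by
  refine lc_ext (f := bd 0 ∘ₗ cone b 0) (g := LinearMap.id) (fun v => ?_) x
  simp only [LinearMap.comp_apply, cone_single, bd_single, LinearMap.id_apply]
  simp

lemma bd_cone (b : E) (n : ℕ) (x : LC E (n + 1)) :
    bd (n + 1) (cone b (n + 1) x) = x - cone b n (bd n x) := by
  refine lc_ext (f := bd (n + 1) ∘ₗ cone b (n + 1)) (g := LinearMap.id - cone b n ∘ₗ bd n)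
    (fun v => ?_) x
  simp only [LinearMap.comp_apply, cone_single, bd_single, LinearMap.id_apply,
    LinearMap.sub_apply, map_sum, map_smul]
  rw [Fin.sum_univ_succ, sub_eq_add_neg, ← Finset.sum_neg_distrib]
  congr 1
  · simp
  · refine Finset.sum_congr rfl fun i _ => ?_
    rw [← neg_smul]
    congr 1
    · simp [pow_succ]
    · congr 1
      funext j
      refine Fin.cases ?_ (fun j => ?_) j <;> simp

lemma bd_bd (n : ℕ) (x : LC E (n + 2)) : bd n (bd (n + 1) x) = 0 := by
  induction n with
  | zero =>
    refine lc_ext (f := bd 0 ∘ₗ bd 1) (g := 0) (fun v => ?_) x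
    have : Finsupp.single v (1 : ℚ) = cone (v 0) 1 (Finsupp.single (Fin.tail v) 1) := by
      rw [cone_single, Fin.cons_self_tail]
    rw [LinearMap.comp_apply, this, bd_cone, map_sub, bd_cone_zero]; simp
  | succ n ih =>
    refine lc_ext (f := bd (n + 1) ∘ₗ bd (n + 2)) (g := 0) (fun v => ?_) x
    have : Finsupp.single v (1 : ℚ) = cone (v 0) (n + 2) (Finsupp.single (Fin.tail v) 1) := by
      rw [cone_single, Fin.cons_self_tail]
    rw [LinearMap.comp_apply, this, bd_cone, map_sub, bd_cone, ih]; simp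

lemma push_bd (f : E → F) (n : ℕ) (x : LC E (n + 1)) :
    push f n (bd n x) = bd n (push f (n + 1) x) := by
  refine lc_ext (f := push f n ∘ₗ bd n) (g := bd n ∘ₗ push f (n + 1)) (fun v => ?_) x
  simp only [LinearMap.comp_apply, bd_single, push_single, map_sum, map_smul, Function.comp_assoc]

lemma push_cone (f : E → F) (b : E) (n : ℕ) (x : LC E n) :
    push f (n + 1) (cone b n x) = cone (f b) n (push f n x) := by
  refine lc_ext (f := push f (n + 1) ∘ₗ cone b n) (g := cone (f b) n ∘ₗ push f n) (fun v => ?_) x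
  simp only [LinearMap.comp_apply, cone_single, push_single]
  congr 1
  funext j
  refine Fin.cases ?_ (fun j => ?_) j <;> simp

variable (β : ∀ n : ℕ, (Fin (n + 1) → E) → E) (γ : ∀ n : ℕ, (Fin (n + 1) → F) → F)

noncomputable def sdL : ∀ n : ℕ, LC E n →ₗ[ℚ] LC E n
  | 0 => LinearMap.id
  | n + 1 => Finsupp.lsum ℚ fun v => LinearMap.toSpanSingleton ℚ _
      (cone (β n v) n (sdL n (bd n (Finsupp.single v 1))))

noncomputable def tL : ∀ n : ℕ, LC E n →ₗ[ℚ] LC E (n + 1)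
  | 0 => 0
  | n + 1 => Finsupp.lsum ℚ fun v => LinearMap.toSpanSingleton ℚ _
      (cone (β n v) (n + 1) (Finsupp.single v 1 - tL n (bd n (Finsupp.single v 1))))

lemma sdL_single (n : ℕ) (v : Fin (n + 1) → E) : sdL β (n + 1) (Finsupp.single v 1) =
    cone (β n v) n (sdL β n (bd n (Finsupp.single v 1))) := by
  simp [sdL]

lemma tL_single (n : ℕ) (v : Fin (n + 1) → E) : tL β (n + 1) (Finsupp.single v 1) =
    cone (β n v) (n + 1) (Finsupp.single v 1 - tL β n (bd n (Finsupp.single v 1))) := by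
  simp [tL]

lemma bd_sdL (n : ℕ) (x : LC E (n + 1)) : bd n (sdL β (n + 1) x) = sdL β n (bd n x) := by
  induction n with
  | zero =>
    refine lc_ext (f := bd 0 ∘ₗ sdL β 1) (g := sdL β 0 ∘ₗ bd 0) (fun v => ?_) x
    rw [LinearMap.comp_apply, sdL_single, bd_cone_zero]; rfl
  | succ n ih =>
    refine lc_ext (f := bd (n + 1) ∘ₗ sdL β (n + 2)) (g := sdL β (n + 1) ∘ₗ bd (n + 1))
      (fun v => ?_) x
    rw [LinearMap.comp_apply, sdL_single, bd_cone, ih, bd_bd]; simp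

lemma bd_tL (n : ℕ) (x : LC E (n + 1)) :
    bd (n + 1) (tL β (n + 1) x) + tL β n (bd n x) = x - sdL β (n + 1) x := by
  induction n with
  | zero =>
    refine lc_ext (f := bd 1 ∘ₗ tL β 1 + tL β 0 ∘ₗ bd 0) (g := LinearMap.id - sdL β 1)
      (fun v => ?_) x
    simp only [LinearMap.add_apply, LinearMap.sub_apply, LinearMap.comp_apply, LinearMap.id_apply]
    rw [tL_single, bd_cone, sdL_single]; simp [tL, sdL]
  | succ n ih =>
    refine lc_ext (f := bd (n + 2) ∘ₗ tL β (n + 2) + tL β (n + 1) ∘ₗ bd (n + 1))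
      (g := LinearMap.id - sdL β (n + 2)) (fun v => ?_) x
    simp only [LinearMap.add_apply, LinearMap.sub_apply, LinearMap.comp_apply, LinearMap.id_apply]
    have h := ih (bd (n + 1) (Finsupp.single v 1))
    rw [bd_bd, map_zero, add_zero] at h
    rw [tL_single, bd_cone, sdL_single, map_sub (bd (n + 1)), h]
    simp only [map_sub]; abel

variable {β γ}

lemma push_sdL {f : E → F} (hf : ∀ n v, f (β n v) = γ n (f ∘ v)) (n : ℕ) (x : LC E n) :
    push f n (sdL β n x) = sdL γ n (push f n x) := by
  induction n with
  | zero => rfl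
  | succ n ih =>
    refine lc_ext (f := push f (n + 1) ∘ₗ sdL β (n + 1)) (g := sdL γ (n + 1) ∘ₗ push f (n + 1))
      (fun v => ?_) x
    rw [LinearMap.comp_apply, sdL_single, push_cone, ih, push_bd, LinearMap.comp_apply,
      push_single, sdL_single, hf]

lemma push_tL {f : E → F} (hf : ∀ n v, f (β n v) = γ n (f ∘ v)) (n : ℕ) (x : LC E n) :
    push f (n + 1) (tL β n x) = tL γ n (push f n x) := by
  induction n with
  | zero => simp [tL]
  | succ n ih =>
    refine lc_ext (f := push f (n + 2) ∘ₗ tL β (n + 1)) (g := tL γ (n + 1) ∘ₗ push f (n + 1))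
      (fun v => ?_) x
    rw [LinearMap.comp_apply, tL_single, push_cone, map_sub, ih, push_bd, LinearMap.comp_apply,
      push_single, tL_single, hf]

/-- linear chains all of whose simplices satisfy a predicate -/
noncomputable abbrev sup (n : ℕ) (P : (Fin n → E) → Prop) : Submodule ℚ (LC E n) :=
  Finsupp.supported ℚ ℚ {v | P v}

lemma sup_map {n m : ℕ} {P : (Fin n → E) → Prop} {Q : (Fin m → E) → Prop}
    (f : LC E n →ₗ[ℚ] LC E m) (h : ∀ v, P v → f (Finsupp.single v 1) ∈ sup m Q)
    {x : LC E n} (hx : x ∈ sup n P) : f x ∈ sup m Q := by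
  have : sup n P ≤ (sup m Q).comap f := by
    rw [sup, Finsupp.supported_eq_span_single, Submodule.span_le]
    rintro _ ⟨v, hv, rfl⟩
    exact h v hv
  exact this hx

lemma single_mem_sup {n : ℕ} {P : (Fin n → E) → Prop} {v : Fin n → E} (h : P v) :
    Finsupp.single v 1 ∈ sup n P := Finsupp.single_mem_supported _ _ h

/-- points in subdivided simplices stay in any set closed under barycenters -/
lemma sdL_points (K : Set E) (hK : ∀ n v, (∀ i, v i ∈ K) → β n v ∈ K) (n : ℕ) {x : LC E n}
    (hx : x ∈ sup n (fun v => ∀ i, v i ∈ K)) : sdL β n x ∈ sup n (fun v => ∀ i, v i ∈ K) := by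
  induction n with
  | zero => exact hx
  | succ n ih =>
    refine sup_map (sdL β (n + 1)) (fun v hv => ?_) hx
    rw [sdL_single]
    refine sup_map (P := fun v => ∀ i, v i ∈ K) (cone (β n v) n) (fun w hw => ?_) (ih ?_)
    · rw [cone_single]
      refine single_mem_sup fun i => ?_
      refine Fin.cases ?_ (fun j => ?_) i
      · simpa using hK n v hv
      · simpa using hw j
    · rw [bd_single]
      exact Submodule.sum_mem _ fun i _ => Submodule.smul_mem _ _
        (single_mem_sup fun j => hv _)

lemma sdL_mesh [PseudoMetricSpace E] {N : ℕ} {r : ℝ} (hr : r = N / (N + 1))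
    (hball : ∀ n v (p : E), dist (β n v) p ≤ (∑ j, dist (v j) p) / (n + 1))
    (n : ℕ) (hn : n ≤ N + 1) {δ : ℝ} (hδ : 0 ≤ δ) {x : LC E n}
    (hx : x ∈ sup n (fun v => ∀ i j, dist (v i) (v j) ≤ δ)) :
    sdL β n x ∈ sup n (fun v => ∀ i j, dist (v i) (v j) ≤ r * δ) := by
  have hr0 : 0 ≤ r := by rw [hr]; positivity
  induction n with
  | zero => 
    refine sup_map (sdL β 0) (fun v _ => ?_) hx
    exact single_mem_sup fun i => i.elim0
  | succ n ih =>
    refine sup_map (sdL β (n + 1)) (fun v hv => ?_) hx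
    rw [sdL_single]
    have hvb : ∀ i, dist (v i) (β n v) ≤ r * δ := by
      intro i
      rw [dist_comm]
      refine (hball n v (v i)).trans ?_
      have h1 : ∑ j, dist (v j) (v i) ≤ n * δ := by
        rw [← Finset.sum_erase_add _ _ (Finset.mem_univ i), dist_self, add_zero]
        refine (Finset.sum_le_card_nsmul _ _ δ fun j _ => hv j i).trans ?_
        simp
      have hnN : (n : ℝ) / (n + 1) ≤ r := by
        rw [hr, div_le_div_iff₀ (by positivity) (by positivity)]
        have : (n : ℝ) ≤ N := by exact_mod_cast (by omega : n ≤ N)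
        nlinarith
      calc (∑ j, dist (v j) (v i)) / (n + 1) ≤ n * δ / (n + 1) := by gcongr
        _ = n / (n + 1) * δ := by ring
        _ ≤ r * δ := by gcongr
    have hm : bd n (Finsupp.single v 1) ∈ sup n (fun w => ∀ i, ∃ j, w i = v j) := by
      rw [bd_single]
      exact Submodule.sum_mem _ fun i _ => Submodule.smul_mem _ _
        (single_mem_sup fun j => ⟨_, rfl⟩)
    have m1 : sdL β n (bd n (Finsupp.single v 1)) ∈
        sup n (fun v => ∀ i j, dist (v i) (v j) ≤ r * δ) := by
      refine ih (by omega) (Finsupp.supported_mono ?_ hm)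
      intro w hw i j
      obtain ⟨i', e⟩ := hw i
      obtain ⟨j', e'⟩ := hw j
      rw [e, e']; exact hv _ _
    have m2 : sdL β n (bd n (Finsupp.single v 1)) ∈
        sup n (fun w => ∀ i, w i ∈ Metric.closedBall (β n v) (r * δ)) := by
      refine sdL_points _ ?_ n (Finsupp.supported_mono ?_ hm)
      · intro m w hw
        rw [Metric.mem_closedBall]
        refine (hball m w _).trans ?_
        rw [div_le_iff₀ (by positivity)]
        refine (Finset.sum_le_card_nsmul _ _ (r * δ) fun j _ => hw j).trans ?_
        simp [mul_comm]
      · intro w hw i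
        obtain ⟨i', e⟩ := hw i
        show w i ∈ _
        rw [e]; exact hvb _
    have m3 : sdL β n (bd n (Finsupp.single v 1)) ∈
        sup n (fun w => (∀ i j, dist (w i) (w j) ≤ r * δ) ∧
          ∀ i, w i ∈ Metric.closedBall (β n v) (r * δ)) := by
      rw [Finsupp.mem_supported] at m1 m2 ⊢
      exact fun w hw => ⟨m1 hw, m2 hw⟩
    refine sup_map (cone (β n v) n) (fun w hw => ?_) m3
    rw [cone_single]
    refine single_mem_sup fun i j => ?_
    refine Fin.cases ?_ (fun i => ?_) i <;> refine Fin.cases ?_ (fun j => ?_) j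
    · simp; positivity
    · simpa [dist_comm] using hw.2 j
    · simpa using hw.2 i
    · simpa using hw.1 i j

end Lin
end HC


namespace HC

/-! ### Part 2: singular chains (total complex) and subdivision -/
section Sing

/-- the standard simplex -/
abbrev Dl (k : ℕ) : Type := stdSimplex ℝ (Fin (k + 1))

lemma comb_mem {j k : ℕ} (v : Fin (j + 1) → Dl k) (x : Dl j) :
    (∑ i, x i • ((v i : Dl k) : Fin (k + 1) → ℝ)) ∈ stdSimplex ℝ (Fin (k + 1)) :=
  (convex_stdSimplex ℝ (Fin (k + 1))).sum_mem (fun i _ => x.2.1 i) x.2.2 (fun i _ => (v i).2)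

noncomputable def comb {j k : ℕ} (v : Fin (j + 1) → Dl k) : C(Dl j, Dl k) where
  toFun x := ⟨∑ i, x i • ((v i : Dl k) : Fin (k + 1) → ℝ), comb_mem v x⟩
  continuous_toFun := by
    refine Continuous.subtype_mk ?_ _
    refine continuous_finsetSum _ fun i _ => ?_
    exact ((continuous_apply i).comp continuous_subtype_val).smul continuous_const

lemma comb_coe {j k : ℕ} (v : Fin (j + 1) → Dl k) (x : Dl j) :
    ((comb v x : Dl k) : Fin (k + 1) → ℝ) = ∑ i, x i • ((v i : Dl k) : Fin (k + 1) → ℝ) := rfl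

lemma comb_apply {j k : ℕ} (v : Fin (j + 1) → Dl k) (x : Dl j) (a : Fin (k + 1)) :
    (comb v x) a = ∑ i, x i * v i a := by
  have := congrFun (comb_coe v x) a
  simpa using this

lemma comb_comb {i j k : ℕ} (w : Fin (j + 1) → Dl k) (v : Fin (i + 1) → Dl j) (x : Dl i) :
    comb w (comb v x) = comb (comb w ∘ v) x := by
  refine stdSimplex.ext (funext fun a => ?_)
  show (comb w (comb v x)) a = (comb (comb w ∘ v) x) a
  simp only [comb_apply, Function.comp_apply, Finset.sum_mul, Finset.mul_sum]
  rw [Finset.sum_comm]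
  simp only [mul_assoc]

/-- the face map -/
noncomputable def face {k : ℕ} (i : Fin (k + 2)) : C(Dl k, Dl (k + 1)) :=
  ⟨stdSimplex.map i.succAbove, stdSimplex.continuous_map _⟩

lemma face_apply {k : ℕ} (i : Fin (k + 2)) (x : Dl k) (a : Fin (k + 2)) :
    (face i x) a = ∑ b, if i.succAbove b = a then x b else 0 := by
  have : ((face i x : Dl (k+1)) : Fin (k + 2) → ℝ) a = _ := congrFun (stdSimplex.map_coe i.succAbove x) a
  rw [FunOnFinite.linearMap_apply_apply] at this
  rw [← Finset.sum_filter]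
  exact this

lemma comb_face {j k : ℕ} (v : Fin (j + 2) → Dl k) (i : Fin (j + 2)) :
    (comb v).comp (face i) = comb (v ∘ i.succAbove) := by
  ext x a
  show (comb v (face i x)) a = (comb (v ∘ i.succAbove) x) a
  simp only [comb_apply, face_apply, Finset.sum_mul, ite_mul, zero_mul]
  rw [Finset.sum_comm]
  simp

/-- vertices -/
noncomputable def vtx (k : ℕ) : Fin (k + 1) → Dl k := fun i => stdSimplex.vertex i

lemma vtx_apply (k : ℕ) (i a : Fin (k + 1)) : vtx k i a = if i = a then 1 else 0 := by
  have : ((vtx k i : Dl k) : Fin (k + 1) → ℝ) a = _ := congrFun (stdSimplex.vertex_coe i) a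
  rw [Pi.single_apply] at this
  simp only [eq_comm (a := a)] at this
  exact this

lemma comb_vtx (k : ℕ) : comb (vtx k) = ContinuousMap.id _ := by
  ext x a
  show (comb (vtx k) x) a = x a
  simp [comb_apply, vtx_apply]

lemma comb_vtx_apply {j k : ℕ} (v : Fin (j + 1) → Dl k) (i : Fin (j + 1)) :
    comb v (vtx j i) = v i := by
  refine stdSimplex.ext (funext fun a => ?_)
  show (comb v (vtx j i)) a = v i a
  simp [comb_apply, vtx_apply]

/-- barycenter -/
noncomputable def bary {k : ℕ} (n : ℕ) (v : Fin (n + 1) → Dl k) : Dl k :=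
  comb v stdSimplex.barycenter

lemma comb_bary {j k : ℕ} (w : Fin (j + 1) → Dl k) (n : ℕ) (v : Fin (n + 1) → Dl j) :
    comb w (bary n v) = bary n (comb w ∘ v) := comb_comb _ _ _

lemma dist_comb_le {j k : ℕ} (v : Fin (j + 1) → Dl k) (x : Dl j) (p : Dl k) :
    dist (comb v x) p ≤ ∑ i, x i * dist (v i) p := by
  have hp : p.1 = ∑ i, x i • p.1 := by
    rw [← Finset.sum_smul, stdSimplex.sum_eq_one, one_smul]
  have hc : (comb v x).1 = ∑ i, x i • (v i).1 := rfl
  rw [Subtype.dist_eq, dist_eq_norm, hc]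
  conv_lhs => rw [hp]
  rw [← Finset.sum_sub_distrib]
  refine (norm_sum_le _ _).trans (Finset.sum_le_sum fun i _ => ?_)
  rw [← smul_sub, norm_smul, Subtype.dist_eq, dist_eq_norm, Real.norm_of_nonneg (show 0 ≤ x i from x.2.1 i)]

lemma dist_bary {k : ℕ} (n : ℕ) (v : Fin (n + 1) → Dl k) (p : Dl k) :
    dist (bary n v) p ≤ (∑ j, dist (v j) p) / (n + 1) := by
  refine (dist_comb_le _ _ _).trans (le_of_eq ?_)
  rw [Finset.sum_div]
  refine Finset.sum_congr rfl fun i _ => ?_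
  have : (stdSimplex.barycenter : Dl n) i = ((n : ℝ) + 1)⁻¹ := by
    have h := stdSimplex.barycenter_apply (𝕜 := ℝ) i
    simp only [Fintype.card_fin, Nat.cast_add, Nat.cast_one] at h
    exact h
  rw [this]; ring

variable {X : Type*} [TopologicalSpace X]

/-- singular simplices of all dimensions -/
abbrev Sing (X : Type*) [TopologicalSpace X] : Type _ := Σ k : ℕ, C(Dl k, X)

/-- total module of singular chains -/
abbrev SC (X : Type*) [TopologicalSpace X] : Type _ := Sing X →₀ ℚ

/-- boundary of a simplex -/
noncomputable def dS : Sing X → SC X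
  | ⟨0, _⟩ => 0
  | ⟨k + 1, σ⟩ => ∑ i : Fin (k + 2), (-1 : ℚ) ^ (i : ℕ) • Finsupp.single ⟨k, σ.comp (face i)⟩ 1

noncomputable def extS {N : Type*} [AddCommGroup N] [Module ℚ N] (f : Sing X → N) :
    SC X →ₗ[ℚ] N :=
  Finsupp.lsum ℚ fun s => LinearMap.toSpanSingleton ℚ _ (f s)

@[simp] lemma extS_single {N : Type*} [AddCommGroup N] [Module ℚ N] (f : Sing X → N) (s : Sing X) :
    extS f (Finsupp.single s 1) = f s := by simp [extS]

lemma sc_ext {N : Type*} [AddCommGroup N] [Module ℚ N] {f g : SC X →ₗ[ℚ] N}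
    (h : ∀ s, f (Finsupp.single s 1) = g (Finsupp.single s 1)) (x : SC X) : f x = g x := by
  have : f = g := by
    apply Finsupp.lhom_ext'
    intro v
    apply LinearMap.ext_ring
    exact h v
  rw [this]

/-- total boundary -/
noncomputable def dd : SC X →ₗ[ℚ] SC X := extS dS

/-- push forward of linear chains -/
noncomputable def pf {k : ℕ} (σ : C(Dl k, X)) : ∀ n : ℕ, LC (Dl k) n →ₗ[ℚ] SC X
  | 0 => 0
  | n + 1 => Finsupp.lmapDomain ℚ ℚ (fun v => (⟨n, σ.comp (comb v)⟩ : Sing X))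

lemma pf_single {k : ℕ} (σ : C(Dl k, X)) (n : ℕ) (v : Fin (n + 1) → Dl k) :
    pf σ (n + 1) (Finsupp.single v 1) = Finsupp.single ⟨n, σ.comp (comb v)⟩ 1 := by
  simp [pf]

lemma pf_vtx {k : ℕ} (σ : C(Dl k, X)) :
    pf σ (k + 1) (Finsupp.single (vtx k) 1) = Finsupp.single ⟨k, σ⟩ 1 := by
  rw [pf_single, comb_vtx, ContinuousMap.comp_id]

lemma dd_pf {k : ℕ} (σ : C(Dl k, X)) (n : ℕ) (x : LC (Dl k) (n + 1)) :
    dd (pf σ (n + 1) x) = pf σ n (bd n x) := by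
  refine lc_ext (f := dd ∘ₗ pf σ (n + 1)) (g := pf σ n ∘ₗ bd n) (fun v => ?_) x
  rw [LinearMap.comp_apply, LinearMap.comp_apply, pf_single, bd_single, dd, extS_single]
  cases n with
  | zero => simp [dS, pf]
  | succ n =>
    simp only [dS, map_sum, map_smul, pf_single]
    refine Finset.sum_congr rfl fun i _ => ?_
    rw [ContinuousMap.comp_assoc, comb_face]

lemma dd_dd (x : SC X) : dd (dd x) = 0 := by
  refine sc_ext (f := dd ∘ₗ dd) (g := 0) ?_ x
  rintro ⟨k, σ⟩
  rw [LinearMap.comp_apply, ← pf_vtx, dd_pf]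
  cases k with
  | zero => simp [pf]
  | succ k => rw [dd_pf, bd_bd]; simp

lemma pf_comp {k j : ℕ} (σ : C(Dl k, X)) (v : Fin (j + 1) → Dl k) (n : ℕ) (x : LC (Dl j) n) :
    pf (σ.comp (comb v)) n x = pf σ n (push (comb v) n x) := by
  cases n with
  | zero => simp [pf]
  | succ n =>
    refine lc_ext (f := pf (σ.comp (comb v)) (n + 1)) (g := pf σ (n + 1) ∘ₗ push (comb v) (n + 1))
      (fun w => ?_) x
    rw [LinearMap.comp_apply, push_single, pf_single, pf_single, ContinuousMap.comp_assoc]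
    congr 3
    ext1 y
    exact comb_comb _ _ _

/-- subdivision -/
noncomputable def sd : SC X →ₗ[ℚ] SC X :=
  extS fun s => pf s.2 (s.1 + 1) (sdL bary (s.1 + 1) (Finsupp.single (vtx s.1) 1))

/-- subdivision homotopy -/
noncomputable def th : SC X →ₗ[ℚ] SC X :=
  extS fun s => pf s.2 (s.1 + 2) (tL bary (s.1 + 1) (Finsupp.single (vtx s.1) 1))

lemma sd_pf {k : ℕ} (σ : C(Dl k, X)) (n : ℕ) (x : LC (Dl k) n) :
    sd (pf σ n x) = pf σ n (sdL bary n x) := by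
  cases n with
  | zero => simp [pf]
  | succ n =>
    refine lc_ext (f := sd ∘ₗ pf σ (n + 1)) (g := pf σ (n + 1) ∘ₗ sdL bary (n + 1)) (fun v => ?_) x
    rw [LinearMap.comp_apply, LinearMap.comp_apply, pf_single, sd, extS_single]
    dsimp only
    rw [pf_comp, push_sdL (γ := bary) (fun m w => comb_bary v m w), push_single,
      show (comb v) ∘ vtx n = v from funext (comb_vtx_apply v)]

lemma th_pf {k : ℕ} (σ : C(Dl k, X)) (n : ℕ) (x : LC (Dl k) n) :
    th (pf σ n x) = pf σ (n + 1) (tL bary n x) := by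
  cases n with
  | zero => simp [pf, tL]
  | succ n =>
    refine lc_ext (f := th ∘ₗ pf σ (n + 1)) (g := pf σ (n + 2) ∘ₗ tL bary (n + 1)) (fun v => ?_) x
    rw [LinearMap.comp_apply, LinearMap.comp_apply, pf_single, th, extS_single]
    dsimp only
    rw [pf_comp, push_tL (γ := bary) (fun m w => comb_bary v m w), push_single,
      show (comb v) ∘ vtx n = v from funext (comb_vtx_apply v)]

lemma dd_sd (x : SC X) : dd (sd x) = sd (dd x) := by
  refine sc_ext (f := dd ∘ₗ sd) (g := sd ∘ₗ dd) ?_ x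
  rintro ⟨k, σ⟩
  rw [LinearMap.comp_apply, LinearMap.comp_apply, ← pf_vtx, sd_pf, dd_pf, dd_pf, sd_pf, bd_sdL]

lemma dd_th (x : SC X) : x = sd x + (th (dd x) + dd (th x)) := by
  refine sc_ext (f := LinearMap.id) (g := sd + (th ∘ₗ dd + dd ∘ₗ th)) ?_ x
  rintro ⟨k, σ⟩
  simp only [LinearMap.add_apply, LinearMap.comp_apply, LinearMap.id_apply]
  rw [← pf_vtx, sd_pf, th_pf, dd_pf, dd_pf, th_pf, ← map_add, ← map_add,
    add_comm (tL bary k _), bd_tL]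
  congr 1; abel

/-- chains in a subset -/
noncomputable def CU (U : Set X) : Submodule ℚ (SC X) :=
  Finsupp.supported ℚ ℚ {s | ∀ x, s.2 x ∈ U}

lemma CU_le {U : Set X} {B : Submodule ℚ (SC X)}
    (h : ∀ s : Sing X, (∀ x, s.2 x ∈ U) → Finsupp.single s 1 ∈ B) : CU U ≤ B := by
  rw [CU, Finsupp.supported_eq_span_single, Submodule.span_le]
  rintro _ ⟨v, hv, rfl⟩
  exact h v hv

lemma single_mem_CU {U : Set X} {s : Sing X} (h : ∀ x, s.2 x ∈ U) :
    Finsupp.single s 1 ∈ CU U := Finsupp.single_mem_supported _ _ h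

lemma CU_mono {U V : Set X} (h : U ⊆ V) : CU U ≤ CU V :=
  Finsupp.supported_mono fun _ hs x => h (hs x)

lemma CU_inf (U V : Set X) : CU U ⊓ CU V = CU (U ∩ V) := by
  rw [CU, CU, CU, ← Finsupp.supported_inter]
  congr 1
  ext s
  simp [forall_and]

lemma pf_mem {U : Set X} {k : ℕ} {σ : C(Dl k, X)} (h : ∀ x, σ x ∈ U) (n : ℕ) (x : LC (Dl k) n) :
    pf σ n x ∈ CU U := by
  cases n with
  | zero => simp [pf]
  | succ n =>
    have : (⊤ : Submodule ℚ _) ≤ (CU U).comap (pf σ (n + 1)) := by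
      rw [← Finsupp.supported_univ, Finsupp.supported_eq_span_single, Submodule.span_le]
      rintro _ ⟨v, hv, rfl⟩
      show pf σ (n + 1) (Finsupp.single v 1) ∈ CU U
      rw [pf_single]
      exact single_mem_CU fun y => h _
    exact this trivial

lemma dd_mem {U : Set X} : ∀ a ∈ CU U, dd a ∈ CU U := by
  intro a ha
  refine (CU_le (B := (CU U).comap (dd : SC X →ₗ[ℚ] SC X)) ?_) ha
  rintro ⟨k, σ⟩ h
  show dd (Finsupp.single _ 1) ∈ CU U
  rw [← pf_vtx, dd_pf]
  exact pf_mem h _ _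

lemma sd_mem {U : Set X} : ∀ a ∈ CU U, sd a ∈ CU U := by
  intro a ha
  refine (CU_le (B := (CU U).comap (sd : SC X →ₗ[ℚ] SC X)) ?_) ha
  rintro ⟨k, σ⟩ h
  show sd (Finsupp.single _ 1) ∈ CU U
  rw [← pf_vtx, sd_pf]
  exact pf_mem h _ _

lemma th_mem {U : Set X} : ∀ a ∈ CU U, th a ∈ CU U := by
  intro a ha
  refine (CU_le (B := (CU U).comap (th : SC X →ₗ[ℚ] SC X)) ?_) ha
  rintro ⟨k, σ⟩ h
  show th (Finsupp.single _ 1) ∈ CU U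
  rw [← pf_vtx, th_pf]
  exact pf_mem h _ _

lemma pow_mem {B : Submodule ℚ (SC X)} (h : ∀ b ∈ B, sd b ∈ B) (N : ℕ) :
    ∀ b ∈ B, (sd ^ N) b ∈ B := by
  induction N with
  | zero => intro b hb; simpa using hb
  | succ N ih => intro b hb; rw [pow_succ, Module.End.mul_apply]; exact ih _ (h _ hb)

lemma sd_pow_pf {k : ℕ} (σ : C(Dl k, X)) (n N : ℕ) (x : LC (Dl k) n) :
    (sd ^ N) (pf σ n x) = pf σ n ((sdL bary n ^ N) x) := by
  induction N generalizing x with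
  | zero => simp
  | succ N ih => rw [pow_succ, Module.End.mul_apply, sd_pf, ih, pow_succ, Module.End.mul_apply]

lemma small_simplex {U V : Set X} (hU : IsOpen U) (hV : IsOpen V) {k : ℕ} (σ : C(Dl k, X))
    (h : ∀ x, σ x ∈ U ∪ V) :
    ∃ N, (sd ^ N) (Finsupp.single (⟨k, σ⟩ : Sing X) 1) ∈ CU U ⊔ CU V := by
  obtain ⟨δ, hδ, hL⟩ := lebesgue_number_lemma_of_metric (s := (Set.univ : Set (Dl k)))
    (c := fun b : Bool => if b then σ ⁻¹' U else σ ⁻¹' V) isCompact_univ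
    (by intro b; cases b
        · simpa using hV.preimage σ.continuous
        · simpa using hU.preimage σ.continuous)
    (by intro x _
        rcases h x with h | h
        · exact Set.mem_iUnion.2 ⟨true, by simpa using h⟩
        · exact Set.mem_iUnion.2 ⟨false, by simpa using h⟩)
  set r : ℝ := (k : ℝ) / (k + 1) with hr
  have hr0 : 0 ≤ r := by positivity
  have hr1 : r < 1 := by rw [hr, div_lt_one (by positivity)]; linarith
  set d0 := Metric.diam (Set.univ : Set (Dl k)) with hd0
  have hd0n : 0 ≤ d0 := Metric.diam_nonneg
  obtain ⟨N, hN⟩ := exists_pow_lt_of_lt_one (y := r) (x := δ / (d0 + 1)) (by positivity) hr1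
  have hN' : r ^ N * d0 < δ := by
    rw [lt_div_iff₀ (by positivity)] at hN
    have : 0 ≤ r ^ N := by positivity
    nlinarith
  have key : ∀ m : ℕ, (sdL bary (k + 1) ^ m) (Finsupp.single (vtx k) 1) ∈
      sup (k + 1) (fun v => ∀ i j, dist (v i) (v j) ≤ r ^ m * d0) := by
    intro m
    induction m with
    | zero =>
      refine single_mem_sup fun i j => ?_
      simpa using Metric.dist_le_diam_of_mem isCompact_univ.isBounded trivial trivial
    | succ m ih =>
      rw [pow_succ' (sdL bary (k + 1)) m, Module.End.mul_apply, pow_succ' r m, mul_assoc]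
      exact sdL_mesh hr dist_bary (k + 1) le_rfl (by positivity) ih
  refine ⟨N, ?_⟩
  rw [← pf_vtx, sd_pow_pf]
  have : sup (k + 1) (fun v => ∀ i j, dist (v i) (v j) ≤ r ^ N * d0) ≤
      (CU U ⊔ CU V).comap (pf σ (k + 1)) := by
    rw [sup, Finsupp.supported_eq_span_single, Submodule.span_le]
    rintro _ ⟨v, hv, rfl⟩
    show pf σ (k + 1) (Finsupp.single v 1) ∈ CU U ⊔ CU V
    rw [pf_single]
    have hb : ∀ x, comb v x ∈ Metric.ball (v 0) δ := by
      intro x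
      rw [Metric.mem_ball]
      refine lt_of_le_of_lt ((dist_comb_le v x (v 0)).trans ?_) hN'
      calc ∑ i, x i * dist (v i) (v 0) ≤ ∑ i, x i * (r ^ N * d0) := by
            refine Finset.sum_le_sum fun i _ => ?_
            exact mul_le_mul_of_nonneg_left (hv i 0) (x.2.1 i)
        _ = r ^ N * d0 := by rw [← Finset.sum_mul, stdSimplex.sum_eq_one, one_mul]
    obtain ⟨b, hb'⟩ := hL (v 0) trivial
    cases b with
    | true =>
      exact Submodule.mem_sup_left (single_mem_CU fun x => by simpa using hb' (hb x))
    | false =>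
      exact Submodule.mem_sup_right (single_mem_CU fun x => by simpa using hb' (hb x))
  exact this (key N)

lemma small_chain {U V : Set X} (hU : IsOpen U) (hV : IsOpen V) (b : SC X)
    (hb : b ∈ CU (U ∪ V)) : ∃ N, (sd ^ N) b ∈ CU U ⊔ CU V := by
  have hst : ∀ b ∈ CU U ⊔ CU V, sd b ∈ CU U ⊔ CU V := by
    intro b hb
    obtain ⟨x, hx, y, hy, rfl⟩ := Submodule.mem_sup.1 hb
    rw [map_add]
    exact Submodule.add_mem_sup (sd_mem _ hx) (sd_mem _ hy)
  rw [CU, Finsupp.supported_eq_span_single] at hb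
  induction hb using Submodule.span_induction with
  | mem x hx =>
    obtain ⟨s, hs, rfl⟩ := hx
    exact small_simplex hU hV s.2 hs
  | zero => exact ⟨0, by simp⟩
  | add x y _ _ hx hy =>
    obtain ⟨N, hN⟩ := hx
    obtain ⟨N', hN'⟩ := hy
    refine ⟨N + N', ?_⟩
    rw [map_add]
    refine Submodule.add_mem _ ?_ ?_
    · rw [add_comm, pow_add, Module.End.mul_apply]; exact pow_mem hst _ _ hN
    · rw [pow_add, Module.End.mul_apply]; exact pow_mem hst _ _ hN'
  | smul q x _ hx =>
    obtain ⟨N, hN⟩ := hx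
    exact ⟨N, by rw [map_smul]; exact Submodule.smul_mem _ _ hN⟩

/-- small chains theorem, abstract version -/
lemma rel_small {A B : Submodule ℚ (SC X)} (hA : ∀ a ∈ A, th a ∈ A) (hA' : ∀ a ∈ A, sd a ∈ A)
    (hB : ∀ a ∈ B, th a ∈ B)
    (hB' : ∀ a ∈ B, sd a ∈ B) (h : ∀ b ∈ B, ∃ N, (sd ^ N) b ∈ A) : Rel dd A B := by
  intro b hb hdb
  obtain ⟨N, hN⟩ := h b hb
  induction N generalizing b with
  | zero => exact ⟨b, by simpa using hN, 0, B.zero_mem, by simp⟩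
  | succ N ih =>
    obtain ⟨a, ha, c, hc, e⟩ := ih (sd b) (hB' _ hb) (by rw [dd_sd]; exact hA' _ hdb)
      (by rw [pow_succ, Module.End.mul_apply] at hN; exact hN)
    refine ⟨a + th (dd b), A.add_mem ha (hA _ hdb), c + th b, B.add_mem hc (hB _ hb), ?_⟩
    conv_lhs => rw [dd_th b, e]
    rw [map_add]; abel

end Sing
end HC


set_option linter.unusedSectionVars false
namespace HC

/-! ### Part 3: group actions, isotypic chains -/
section Push
variable {X Y : Type*} [TopologicalSpace X] [TopologicalSpace Y]

/-- push forward of singular chains -/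
noncomputable def pu (f : C(X, Y)) : SC X →ₗ[ℚ] SC Y :=
  Finsupp.lmapDomain ℚ ℚ (fun s => (⟨s.1, f.comp s.2⟩ : Sing Y))

lemma pu_single (f : C(X, Y)) (s : Sing X) :
    pu f (Finsupp.single s 1) = Finsupp.single ⟨s.1, f.comp s.2⟩ 1 := by
  simp [pu]

lemma pu_pf (f : C(X, Y)) {k : ℕ} (σ : C(Dl k, X)) (n : ℕ) (x : LC (Dl k) n) :
    pu f (pf σ n x) = pf (f.comp σ) n x := by
  cases n with
  | zero => simp [pf]
  | succ n =>
    refine lc_ext (f := pu f ∘ₗ pf σ (n + 1)) (g := pf (f.comp σ) (n + 1)) (fun v => ?_) x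
    rw [LinearMap.comp_apply, pf_single, pf_single, pu_single]
    rfl

lemma pu_dd (f : C(X, Y)) (x : SC X) : pu f (dd x) = dd (pu f x) := by
  refine sc_ext (f := pu f ∘ₗ dd) (g := dd ∘ₗ pu f) ?_ x
  rintro ⟨k, σ⟩
  rw [LinearMap.comp_apply, LinearMap.comp_apply, ← pf_vtx, dd_pf, pu_pf, pu_pf, dd_pf]

lemma pu_sd (f : C(X, Y)) (x : SC X) : pu f (sd x) = sd (pu f x) := by
  refine sc_ext (f := pu f ∘ₗ sd) (g := sd ∘ₗ pu f) ?_ x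
  rintro ⟨k, σ⟩
  rw [LinearMap.comp_apply, LinearMap.comp_apply, ← pf_vtx, sd_pf, pu_pf, pu_pf, sd_pf]

lemma pu_th (f : C(X, Y)) (x : SC X) : pu f (th x) = th (pu f x) := by
  refine sc_ext (f := pu f ∘ₗ th) (g := th ∘ₗ pu f) ?_ x
  rintro ⟨k, σ⟩
  rw [LinearMap.comp_apply, LinearMap.comp_apply, ← pf_vtx, th_pf, pu_pf, pu_pf, th_pf]

/-- degree projection -/
noncomputable def pr (k : ℕ) : SC X →ₗ[ℚ] SC X :=
  extS fun s => if s.1 = k then Finsupp.single s 1 else 0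

lemma pr_single (k : ℕ) (s : Sing X) :
    pr k (Finsupp.single s 1) = if s.1 = k then Finsupp.single s 1 else 0 := by
  rw [pr, extS_single]

lemma pr_dd (k : ℕ) (x : SC X) : dd (pr (k + 1) x) = pr k (dd x) := by
  refine sc_ext (f := dd ∘ₗ pr (k + 1)) (g := pr k ∘ₗ dd) ?_ x
  rintro ⟨j, σ⟩
  rw [LinearMap.comp_apply, LinearMap.comp_apply, pr_single, dd]
  cases j with
  | zero => simp [dS]
  | succ j =>
    by_cases h : j = k
    · subst h
      simp only [if_true, extS_single, dS, map_sum, map_smul, pr_single]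
    · have h' : ¬ (j + 1 = k + 1) := by omega
      simp only [if_neg h', if_neg h, extS_single, dS, map_sum, map_smul, pr_single, map_zero,
        smul_zero, Finset.sum_const_zero]

lemma pr_zero_dd (x : SC X) : dd (pr 0 x) = 0 := by
  refine sc_ext (f := dd ∘ₗ pr 0) (g := 0) ?_ x
  rintro ⟨j, σ⟩
  rw [LinearMap.comp_apply, pr_single, dd]
  cases j with
  | zero => simp [dS]
  | succ j => simp

lemma pr_pr (k : ℕ) (x : SC X) : pr k (pr k x) = pr k x := by
  refine sc_ext (f := pr k ∘ₗ pr k) (g := pr k) ?_ x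
  intro s
  rw [LinearMap.comp_apply, pr_single]
  split_ifs with h
  · rw [pr_single, if_pos h]
  · simp

lemma pr_pr_ne {j k : ℕ} (hjk : j ≠ k) (x : SC X) : pr j (pr k x) = 0 := by
  refine sc_ext (f := pr j ∘ₗ pr k) (g := 0) ?_ x
  intro s
  rw [LinearMap.comp_apply, pr_single]
  split_ifs with h
  · rw [pr_single, if_neg (by omega)]; simp
  · simp

lemma pu_pr (f : C(X, Y)) (k : ℕ) (x : SC X) : pu f (pr k x) = pr k (pu f x) := by
  refine sc_ext (f := pu f ∘ₗ pr k) (g := pr k ∘ₗ pu f) ?_ x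
  intro s
  rw [LinearMap.comp_apply, LinearMap.comp_apply, pr_single, pu_single, pr_single]
  split_ifs with h
  · rw [pu_single]
  · simp

lemma pr_mem {U : Set X} (k : ℕ) : ∀ a ∈ CU U, pr k a ∈ CU U := by
  intro a ha
  refine (CU_le (B := (CU U).comap (pr k : SC X →ₗ[ℚ] SC X)) ?_) ha
  intro s h
  show pr k (Finsupp.single _ 1) ∈ CU U
  rw [pr_single]
  split_ifs
  · exact single_mem_CU h
  · exact Submodule.zero_mem _

end Push

section Act
variable {X : Type*} [TopologicalSpace X]
variable {G : Type*} [AddCommGroup G] [Fintype G] [AddAction G X] [ContinuousConstVAdd G X]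

/-- translation -/
def tr (g : G) : C(X, X) := ⟨fun x => g +ᵥ x, continuous_const_vadd g⟩

/-- action on chains -/
noncomputable def ac (g : G) : SC X →ₗ[ℚ] SC X := pu (tr g)

lemma ac_add (g h : G) (x : SC X) : ac (g + h) x = ac g (ac h x) := by
  refine sc_ext (f := ac (g + h)) (g := ac g ∘ₗ ac h) ?_ x
  intro s
  rw [LinearMap.comp_apply, ac, ac, ac, pu_single, pu_single, pu_single]
  congr 2
  ext y
  exact add_vadd _ _ _

def Inv (G : Type*) [AddCommGroup G] [AddAction G X] (U : Set X) : Prop :=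
  ∀ (g : G) (x : X), x ∈ U → g +ᵥ x ∈ U

lemma ac_mem {U : Set X} (hU : Inv G U) (g : G) : ∀ a ∈ CU U, ac g a ∈ CU U := by
  intro a ha
  refine (CU_le (B := (CU U).comap (ac g : SC X →ₗ[ℚ] SC X)) ?_) ha
  intro s h
  show ac g (Finsupp.single s 1) ∈ CU U
  rw [ac, pu_single]
  exact single_mem_CU fun x => hU g _ (h x)

/-- isotypic chains in `U` -/
noncomputable def FF (ω : AddChar G ℚ) (U : Set X) : Submodule ℚ (SC X) where
  carrier := {c | c ∈ CU U ∧ ∀ g : G, ac g c = ω g • c}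
  zero_mem' := ⟨Submodule.zero_mem _, by simp⟩
  add_mem' := fun ha hb => ⟨Submodule.add_mem _ ha.1 hb.1, fun g => by
    rw [map_add, ha.2, hb.2, smul_add]⟩
  smul_mem' := fun q a ha => ⟨Submodule.smul_mem _ _ ha.1, fun g => by
    rw [map_smul, ha.2, smul_comm]⟩

variable {ω : AddChar G ℚ}

lemma FF_mem {U : Set X} {c : SC X} : c ∈ FF ω U ↔ c ∈ CU U ∧ ∀ g : G, ac g c = ω g • c := Iff.rfl

/-- projector -/
noncomputable def pj (ω : AddChar G ℚ) : SC X →ₗ[ℚ] SC X :=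
  ((Fintype.card G : ℚ)⁻¹) • ∑ g : G, ω (-g) • ac g

lemma pj_apply (x : SC X) : pj ω x = ((Fintype.card G : ℚ)⁻¹) • ∑ g : G, ω (-g) • ac g x := by
  simp [pj]

lemma pj_mem {U : Set X} (hU : Inv G U) {a : SC X} (ha : a ∈ CU U) : pj ω a ∈ FF ω U := by
  rw [pj_apply]
  refine Submodule.smul_mem _ _ ⟨Submodule.sum_mem _ fun g _ =>
    Submodule.smul_mem _ _ (ac_mem hU g a ha), fun h => ?_⟩
  rw [map_sum, Finset.smul_sum, ← Equiv.sum_comp (Equiv.subRight h)]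
  refine Finset.sum_congr rfl fun g _ => ?_
  rw [map_smul, Equiv.subRight_apply, ← ac_add, smul_smul, ← AddChar.map_add_eq_mul]
  rw [show -(g - h) = h + -g by abel, show h + (g - h) = g by abel]

lemma pj_eq {U : Set X} {a : SC X} (ha : a ∈ FF ω U) : pj ω a = a := by
  rw [pj_apply]
  have : ∀ g : G, ω (-g) • ac g a = a := fun g => by
    rw [ha.2, smul_smul, ← AddChar.map_add_eq_mul, neg_add_cancel, AddChar.map_zero_eq_one, one_smul]
  simp only [this, Finset.sum_const, Finset.card_univ]
  rw [← Nat.cast_smul_eq_nsmul ℚ, smul_smul, inv_mul_cancel₀, one_smul]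
  exact Nat.cast_ne_zero.2 Fintype.card_ne_zero

lemma FF_mono {U V : Set X} (h : U ⊆ V) : FF ω U ≤ FF ω V :=
  fun _ ha => ⟨CU_mono h ha.1, ha.2⟩

lemma FF_inf (U V : Set X) : FF ω U ⊓ FF ω V = FF ω (U ∩ V) := by
  ext a
  constructor
  · rintro ⟨h1, h2⟩
    refine ⟨?_, h1.2⟩
    rw [← CU_inf]; exact ⟨h1.1, h2.1⟩
  · intro h
    exact ⟨FF_mono Set.inter_subset_left h, FF_mono Set.inter_subset_right h⟩

lemma FF_dd {U : Set X} : ∀ a ∈ FF ω U, dd a ∈ FF ω U := fun a ha =>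
  ⟨dd_mem _ ha.1, fun g => by rw [ac, pu_dd, ← ac, ha.2, map_smul]⟩
lemma FF_sd {U : Set X} : ∀ a ∈ FF ω U, sd a ∈ FF ω U := fun a ha =>
  ⟨sd_mem _ ha.1, fun g => by rw [ac, pu_sd, ← ac, ha.2, map_smul]⟩
lemma FF_th {U : Set X} : ∀ a ∈ FF ω U, th a ∈ FF ω U := fun a ha =>
  ⟨th_mem _ ha.1, fun g => by rw [ac, pu_th, ← ac, ha.2, map_smul]⟩
lemma FF_pr {U : Set X} (k : ℕ) : ∀ a ∈ FF ω U, pr k a ∈ FF ω U := fun a ha =>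
  ⟨pr_mem _ _ ha.1, fun g => by rw [ac, pu_pr, ← ac, ha.2, map_smul]⟩

lemma FF_small {U V : Set X} (hU : IsOpen U) (hV : IsOpen V) (iU : Inv G U) (iV : Inv G V) :
    Rel dd (FF ω U ⊔ FF ω V) (FF ω (U ∪ V)) := by
  have sup_st : ∀ f : SC X →ₗ[ℚ] SC X, (∀ a ∈ FF ω U, f a ∈ FF ω U) → (∀ a ∈ FF ω V, f a ∈ FF ω V) →
      ∀ a ∈ FF ω U ⊔ FF ω V, f a ∈ FF ω U ⊔ FF ω V := by
    intro f h1 h2 a ha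
    obtain ⟨x, hx, y, hy, rfl⟩ := Submodule.mem_sup.1 ha
    rw [map_add]; exact Submodule.add_mem_sup (h1 _ hx) (h2 _ hy)
  refine rel_small (sup_st _ FF_th FF_th) (sup_st _ FF_sd FF_sd) FF_th FF_sd ?_
  intro b hb
  obtain ⟨N, hN⟩ := small_chain hU hV b hb.1
  refine ⟨N, ?_⟩
  have h1 : (sd ^ N) b ∈ FF ω (U ∪ V) := pow_mem FF_sd N b hb
  rw [← pj_eq h1]
  obtain ⟨x, hx, y, hy, e⟩ := Submodule.mem_sup.1 hN
  rw [← e, map_add]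
  exact Submodule.add_mem_sup (pj_mem iU hx) (pj_mem iV hy)

/-- union of a list of sets -/
def UL {σ : Type*} (a : σ → Set X) (l : List σ) : Set X := {x | ∃ s ∈ l, x ∈ a s}

lemma UL_cons {σ : Type*} (a : σ → Set X) (t : σ) (l : List σ) : UL a (t :: l) = a t ∪ UL a l := by
  ext x; simp [UL]

lemma UL_open {σ : Type*} {a : σ → Set X} (h : ∀ s, IsOpen (a s)) (l : List σ) :
    IsOpen (UL a l) := by
  induction l with
  | nil => simp [UL]
  | cons t l ih => rw [UL_cons]; exact (h t).union ih

lemma UL_inv {σ : Type*} {a : σ → Set X} (h : ∀ s, Inv G (a s)) (l : List σ) :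
    Inv G (UL a l) := by
  rintro g x ⟨s, hs, hx⟩
  exact ⟨s, hs, h s g x hx⟩

lemma UL_inter {σ : Type*} [SemilatticeInf σ] {a : σ → Set X}
    (h : ∀ s t, a (s ⊓ t) = a s ∩ a t) (t : σ) (l : List σ) :
    a t ∩ UL a l = UL a (l.map (t ⊓ ·)) := by
  ext x
  simp only [UL, Set.mem_inter_iff, Set.mem_ofPred_eq, List.mem_map, exists_exists_and_eq_and, h]
  constructor
  · rintro ⟨h1, s, hs, h2⟩; exact ⟨s, hs, h1, h2⟩
  · rintro ⟨s, hs, h1, h2⟩; exact ⟨h1, s, hs, h2⟩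

lemma rel_UL {σ : Type*} [SemilatticeInf σ] {a b : σ → Set X}
    (oa : ∀ s, IsOpen (a s)) (ob : ∀ s, IsOpen (b s))
    (ia : ∀ s, Inv G (a s)) (ib : ∀ s, Inv G (b s))
    (fa : ∀ s t, a (s ⊓ t) = a s ∩ a t) (fb : ∀ s t, b (s ⊓ t) = b s ∩ b t)
    (hab : ∀ s, a s ⊆ b s) {K : σ → Prop} (hK : ∀ s t, K s → K t → K (s ⊓ t))
    (h : ∀ s, K s → Rel dd (FF ω (a s)) (FF ω (b s))) (l : List σ) (hl : ∀ s ∈ l, K s) :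
    Rel dd (FF ω (UL a l)) (FF ω (UL b l)) := by
  obtain ⟨N, hN⟩ : ∃ N, l.length = N := ⟨_, rfl⟩
  induction N generalizing l with
  | zero =>
    rw [List.length_eq_zero_iff] at hN
    subst hN
    have : UL b [] = UL a [] := by ext; simp [UL]
    rw [this]
    exact fun x hx _ => ⟨x, hx, 0, Submodule.zero_mem _, by simp⟩
  | succ N ih =>
    cases l with
    | nil => simp at hN
    | cons t l =>
      simp only [List.length_cons, add_left_inj] at hN
      have ht : K t := hl t (by simp)
      have hl' : ∀ s ∈ l, K s := fun s hs => hl s (by simp [hs])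
      have hUL : UL a l ⊆ UL b l := fun x ⟨s, hs, hx⟩ => ⟨s, hs, hab s hx⟩
      rw [UL_cons, UL_cons]
      refine Rel.union' dd_dd (A1 := FF ω (a t)) (A2 := FF ω (UL a l)) (B1 := FF ω (b t))
        (B2 := FF ω (UL b l)) FF_dd FF_dd FF_dd FF_dd (FF_mono (hab t)) (FF_mono hUL)
        (FF_mono (Set.union_subset_union (hab t) hUL))
        (sup_le (FF_mono Set.subset_union_left) (FF_mono Set.subset_union_right))
        (sup_le (FF_mono Set.subset_union_left) (FF_mono Set.subset_union_right))
        (FF_small (oa t) (UL_open oa l) (ia t) (UL_inv ia l))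
        (FF_small (ob t) (UL_open ob l) (ib t) (UL_inv ib l)) (h t ht) (ih l hl' hN) ?_
      rw [FF_inf, FF_inf, UL_inter fa, UL_inter fb]
      refine ih _ ?_ (by simpa using hN)
      intro s hs
      obtain ⟨s', hs', rfl⟩ := List.mem_map.1 hs
      exact hK _ _ ht (hl' _ hs')

/-- spherical in degree `k` -/
def SphD (ω : AddChar G ℚ) (U : Set X) (k : ℕ) : Prop :=
  ∃ z, pr k z = z ∧ Sph dd (FF ω U) z

/-- acyclic -/
def Acy (ω : AddChar G ℚ) (U : Set X) : Prop := Rel dd ⊥ (FF ω U)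

lemma SphD.susp {U V : Set X} (hU : IsOpen U) (hV : IsOpen V) (iU : Inv G U) (iV : Inv G V)
    (aU : Acy ω U) (aV : Acy ω V) {k : ℕ} (h : SphD ω (U ∩ V) k) : SphD ω (U ∪ V) (k + 1) := by
  obtain ⟨z, hz, hs⟩ := h
  rw [← FF_inf] at hs
  obtain ⟨c1, hc1, e1⟩ := aU.of_bot z hs.1.1 hs.2.1
  obtain ⟨c2, hc2, e2⟩ := aV.of_bot z hs.1.2 hs.2.1
  refine ⟨pr (k + 1) c1 - pr (k + 1) c2, by rw [map_sub, pr_pr, pr_pr], ?_⟩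
  refine Sph.of_rel dd_dd (sup_le (FF_mono Set.subset_union_left) (FF_mono Set.subset_union_right))
    ?_ (FF_small hU hV iU iV)
  refine Sph.union dd_dd FF_dd FF_dd aU aV hs (FF_pr _ _ hc1) (FF_pr _ _ hc2) ?_ ?_
  · rw [pr_dd, ← e1, hz]
  · rw [pr_dd, ← e2, hz]

lemma Acy.union {U V : Set X} (hU : IsOpen U) (hV : IsOpen V) (iU : Inv G U) (iV : Inv G V)
    (aU : Acy ω U) (aV : Acy ω V) (h : Acy ω (U ∩ V)) : Acy ω (U ∪ V) := by
  have h0 : ∀ a ∈ (⊥ : Submodule ℚ (SC X)), dd a ∈ (⊥ : Submodule ℚ (SC X)) := by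
    intro a ha; rw [Submodule.mem_bot] at ha; simp [ha]
  have h1 := Rel.union dd_dd h0 h0 FF_dd FF_dd bot_le bot_le aU aV (by
    rw [FF_inf, inf_idem]; exact h)
  rw [sup_idem] at h1
  exact Rel.trans bot_le (sup_le (FF_mono Set.subset_union_left) (FF_mono Set.subset_union_right))
    dd_dd h1 (FF_small hU hV iU iV)

end Act
end HC

set_option linter.unusedSectionVars false
namespace HC

/-! ### Part 4: the cone operator -/
section Cone

lemma qm_mem {k : ℕ} (x : Dl k) (t : unitInterval) :
    (Fin.cons (t : ℝ) (fun i => (1 - (t : ℝ)) * x i) : Fin (k + 2) → ℝ) ∈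
      stdSimplex ℝ (Fin (k + 2)) := by
  constructor
  · intro a
    refine Fin.cases ?_ (fun i => ?_) a
    · simpa using t.2.1
    · exact mul_nonneg (sub_nonneg.2 t.2.2) (x.2.1 i)
  · rw [Fin.sum_univ_succ]
    simp only [Fin.cons_zero, Fin.cons_succ]
    rw [← Finset.mul_sum, stdSimplex.sum_eq_one]; ring

/-- the quotient map to the cone -/
noncomputable def qm (k : ℕ) : C(Dl k × unitInterval, Dl (k + 1)) where
  toFun p := ⟨_, qm_mem p.1 p.2⟩
  continuous_toFun := by
    refine Continuous.subtype_mk ?_ _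
    refine continuous_pi fun a => ?_
    refine Fin.cases ?_ (fun i => ?_) a
    · simp only [Fin.cons_zero]; fun_prop
    · simp only [Fin.cons_succ]
      refine Continuous.mul (by fun_prop) ?_
      exact (continuous_apply i).comp (continuous_subtype_val.comp continuous_fst)

lemma qm_zero {k : ℕ} (x : Dl k) (t : unitInterval) : (qm k (x, t)) 0 = t := rfl
lemma qm_succ {k : ℕ} (x : Dl k) (t : unitInterval) (i : Fin (k + 1)) :
    (qm k (x, t)) i.succ = (1 - (t : ℝ)) * x i := rfl

lemma dl_ext {k : ℕ} {x y : Dl k} (h : ∀ a, x a = y a) : x = y :=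
  stdSimplex.ext (funext h)

lemma qm_surj (k : ℕ) : Function.Surjective (qm k) := by
  intro y
  have hs : y 0 + ∑ i : Fin (k + 1), y i.succ = 1 := by
    rw [← Fin.sum_univ_succ]; exact stdSimplex.sum_eq_one y
  have hn : ∀ a, 0 ≤ y a := fun a => y.2.1 a
  have hs0 : 0 ≤ ∑ i : Fin (k + 1), y i.succ := Finset.sum_nonneg fun i _ => hn _
  by_cases h : y 0 = 1
  · refine ⟨(vtx k 0, 1), dl_ext fun a => ?_⟩
    refine Fin.cases ?_ (fun i => ?_) a
    · rw [qm_zero, h]; rfl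
    · rw [qm_succ]
      have : ∑ i : Fin (k + 1), y i.succ = 0 := by linarith
      rw [Finset.sum_eq_zero_iff_of_nonneg (fun i _ => hn _)] at this
      rw [this i (Finset.mem_univ _)]; simp
  · have h1 : 0 < 1 - y 0 := by
      have : y 0 ≤ 1 := by linarith
      rcases this.lt_or_eq with h' | h'
      · linarith
      · exact absurd h' h
    refine ⟨(⟨fun i => y i.succ / (1 - y 0), fun i => div_nonneg (hn _) h1.le, ?_⟩,
      ⟨y 0, hn 0, by linarith⟩), dl_ext fun a => ?_⟩
    · rw [← Finset.sum_div, div_eq_one_iff_eq h1.ne']; linarith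
    · refine Fin.cases ?_ (fun i => ?_) a
      · rw [qm_zero]
      · rw [qm_succ]
        show (1 - y 0) * (y i.succ / (1 - y 0)) = _
        field_simp

lemma qm_quot (k : ℕ) : Topology.IsQuotientMap (qm k) :=
  ((qm k).continuous.isClosedMap).isQuotientMap (qm k).continuous (qm_surj k)

lemma face_zero {k : ℕ} (x : Dl k) : face 0 x = qm k (x, 0) := by
  refine dl_ext fun a => ?_
  rw [face_apply]
  refine Fin.cases ?_ (fun i => ?_) a
  · rw [qm_zero]; simp [Fin.succ_ne_zero]
  · rw [qm_succ]; simp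

lemma face_succ {k : ℕ} (i : Fin (k + 2)) (x : Dl k) (t : unitInterval) :
    face i.succ (qm k (x, t)) = qm (k + 1) (face i x, t) := by
  refine dl_ext fun a => ?_
  rw [face_apply, Fin.sum_univ_succ]
  simp only [qm_zero, qm_succ, Fin.succ_succAbove_zero, Fin.succ_succAbove_succ]
  refine Fin.cases ?_ (fun b => ?_) a
  · rw [qm_zero]; simp [Fin.succ_ne_zero]
  · rw [qm_succ, face_apply, Finset.mul_sum]; simp [(Fin.succ_ne_zero _).symm]

lemma face_one (x : Dl 0) : face 1 x = qm 0 (x, 1) := by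
  refine dl_ext fun a => ?_
  have hx : x 0 = 1 := by simp
  rw [face_apply]
  refine Fin.cases ?_ (fun i => ?_) a
  · rw [qm_zero, Fintype.sum_eq_single 0 (fun b hb => absurd (Fin.fin_one_eq_zero b) hb), hx]; rfl
  · rw [qm_succ, Fintype.sum_eq_single 0 (fun b hb => absurd (Fin.fin_one_eq_zero b) hb),
      Fin.fin_one_eq_zero i]
    simp

instance (k : ℕ) : PreconnectedSpace (Dl k) :=
  Subtype.preconnectedSpace (convex_stdSimplex ℝ (Fin (k + 1))).isPreconnected

instance : Subsingleton (Dl 0) := ⟨fun x y => dl_ext fun a => by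
  have hx : x 0 = 1 := by simp
  have hy : y 0 = 1 := by simp
  rw [Fin.fin_one_eq_zero a, hx, hy]⟩

variable {X : Type*} [TopologicalSpace X]

lemma locconst_eq {Y : Type*} {U : Set X} {f : X → Y} (hf : IsLocallyConstant (fun x : U => f x))
    {k : ℕ} {σ : C(Dl k, X)} (h : ∀ x, σ x ∈ U) (x y : Dl k) : f (σ x) = f (σ y) := by
  have h1 : IsLocallyConstant (fun x : Dl k => f (σ x)) :=
    hf.comp_continuous (f := fun x : Dl k => (⟨σ x, h x⟩ : U))
      (σ.continuous.subtype_mk _)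
  exact h1.apply_eq_of_preconnectedSpace x y

/-- cone data on `U` -/
structure Cn (U : Set X) (H : X → unitInterval → X) : Prop where
  cont : Continuous fun p : U × unitInterval => H p.1 p.2
  zero : ∀ x ∈ U, H x 0 = x
  mem : ∀ x ∈ U, ∀ t, H x t ∈ U
  loc : IsLocallyConstant fun x : U => H x 1

lemma cn_exists {U : Set X} {H : X → unitInterval → X} (hH : Cn U H) {k : ℕ} {σ : C(Dl k, X)}
    (h : ∀ x, σ x ∈ U) : ∃ τ : C(Dl (k + 1), X), ∀ x t, τ (qm k (x, t)) = H (σ x) t := by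
  let f : C(Dl k × unitInterval, X) := ⟨fun p => H (σ p.1) p.2,
    hH.cont.comp (f := fun p : Dl k × unitInterval => ((⟨σ p.1, h p.1⟩ : U), p.2)) (by fun_prop)⟩
  have key : Function.FactorsThrough f (qm k) := by
    rintro ⟨x, t⟩ ⟨y, s⟩ e
    have e0 : t = s := by
      have := congrArg (fun z : Dl (k + 1) => z 0) e
      simp only [qm_zero] at this
      exact Subtype.ext this
    subst e0
    show H (σ x) t = H (σ y) t
    by_cases ht : t = 1
    · subst ht; exact locconst_eq (f := fun x => H x 1) hH.loc h x y
    · have : x = y := dl_ext fun a => by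
        have := congrArg (fun z : Dl (k + 1) => z a.succ) e
        simp only [qm_succ] at this
        refine mul_left_cancel₀ ?_ this
        rw [sub_ne_zero]
        exact fun h => ht (Subtype.ext h.symm)
      rw [this]
  exact ⟨(qm_quot k).lift f key, fun x t =>
    DFunLike.congr_fun ((qm_quot k).lift_comp f key) (x, t)⟩

open Classical in
/-- the cone of a simplex -/
noncomputable def cS (H : X → unitInterval → X) (s : Sing X) : SC X :=
  if h : ∃ τ : C(Dl (s.1 + 1), X), ∀ x t, τ (qm s.1 (x, t)) = H (s.2 x) t then
    Finsupp.single ⟨s.1 + 1, h.choose⟩ 1 else 0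

lemma cS_eq {H : X → unitInterval → X} {k : ℕ} {σ : C(Dl k, X)} {τ : C(Dl (k + 1), X)}
    (h : ∀ x t, τ (qm k (x, t)) = H (σ x) t) : cS H ⟨k, σ⟩ = Finsupp.single ⟨k + 1, τ⟩ 1 := by
  have hh : ∃ τ : C(Dl (k + 1), X), ∀ x t, τ (qm k (x, t)) = H (σ x) t := ⟨τ, h⟩
  have : hh.choose = τ := by
    ext y
    obtain ⟨⟨x, t⟩, rfl⟩ := qm_surj k y
    rw [hh.choose_spec x t, h]
  unfold cS
  rw [dif_pos hh]
  congr 2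

noncomputable def hh (H : X → unitInterval → X) : SC X →ₗ[ℚ] SC X := extS (cS H)

/-- the end point map on zero chains -/
noncomputable def rh (H : X → unitInterval → X) : SC X →ₗ[ℚ] SC X :=
  extS fun s => if s.1 = 0 then
    Finsupp.single ⟨0, ContinuousMap.const _ (H (s.2 (vtx s.1 0)) 1)⟩ 1 else 0

lemma hh_mem {U : Set X} {H : X → unitInterval → X} (hH : Cn U H) :
    ∀ a ∈ CU U, hh H a ∈ CU U := by
  intro a ha
  refine (CU_le (B := (CU U).comap (hh H)) ?_) ha
  rintro ⟨k, σ⟩ h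
  show hh H (Finsupp.single _ 1) ∈ CU U
  obtain ⟨τ, hτ⟩ := cn_exists hH h
  rw [hh, extS_single, cS_eq hτ]
  refine single_mem_CU fun y => ?_
  obtain ⟨⟨x, t⟩, rfl⟩ := qm_surj k y
  show τ _ ∈ U
  rw [hτ]; exact hH.mem _ (h x) t

lemma rh_mem {U : Set X} {H : X → unitInterval → X} (hH : Cn U H) :
    ∀ a ∈ CU U, rh H a ∈ CU U := by
  intro a ha
  refine (CU_le (B := (CU U).comap (rh H)) ?_) ha
  rintro ⟨k, σ⟩ h
  show rh H (Finsupp.single _ 1) ∈ CU U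
  rw [rh, extS_single]
  split_ifs
  · exact single_mem_CU fun y => hH.mem _ (h _) _
  · exact Submodule.zero_mem _

/-- equality on chains in `U` from simplices -/
lemma cu_ext {N : Type*} [AddCommGroup N] [Module ℚ N] {U : Set X} {f g : SC X →ₗ[ℚ] N}
    (h : ∀ s : Sing X, (∀ x, s.2 x ∈ U) → f (Finsupp.single s 1) = g (Finsupp.single s 1)) :
    ∀ a ∈ CU U, f a = g a := by
  intro a ha
  have := (CU_le (B := LinearMap.eqLocus f g) h) ha
  exact this

lemma hh_dd {U : Set X} {H : X → unitInterval → X} (hH : Cn U H) :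
    ∀ a ∈ CU U, dd (hh H a) + hh H (dd a) = a - rh H a := by
  refine cu_ext (f := dd ∘ₗ hh H + hh H ∘ₗ dd) (g := LinearMap.id - rh H) ?_
  rintro ⟨k, σ⟩ h
  simp only [LinearMap.add_apply, LinearMap.sub_apply, LinearMap.comp_apply, LinearMap.id_apply]
  obtain ⟨τ, hτ⟩ := cn_exists hH h
  rw [hh, rh, extS_single, extS_single, cS_eq hτ, dd, extS_single, extS_single]
  have h0 : τ.comp (face 0) = σ := by
    ext x
    show τ (face 0 x) = σ x
    rw [face_zero, hτ, hH.zero _ (h x)]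
  cases k with
  | zero =>
    simp only [dS, map_zero, add_zero, if_true]
    rw [Fin.sum_univ_two]
    simp only [Fin.val_zero, pow_zero, one_smul, Fin.val_one, pow_one, neg_smul, h0]
    rw [← sub_eq_add_neg]
    congr 3
    ext x
    show τ (face 1 x) = _
    rw [face_one, hτ, Subsingleton.elim x (vtx 0 0)]
    rfl
  | succ k =>
    simp only [dS, map_sum, map_smul, extS_single]
    rw [Fin.sum_univ_succ]
    simp only [Fin.val_zero, pow_zero, one_smul, h0, if_neg (Nat.succ_ne_zero k), sub_zero]
    rw [add_assoc, add_eq_left, ← Finset.sum_add_distrib]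
    refine Finset.sum_eq_zero fun i _ => ?_
    rw [cS_eq (τ := τ.comp (face i.succ)), Fin.val_succ, pow_succ]
    · simp
    · intro x t
      show τ (face i.succ (qm k (x, t))) = H (σ (face i x)) t
      rw [face_succ, hτ]

variable {G : Type*} [AddCommGroup G] [Fintype G] [AddAction G X] [ContinuousConstVAdd G X]

lemma hh_ac {U : Set X} {H : X → unitInterval → X} (hH : Cn U H) 
    (eH : ∀ (g : G), ∀ x ∈ U, ∀ t, H (g +ᵥ x) t = g +ᵥ H x t) (g : G) :
    ∀ a ∈ CU U, ac g (hh H a) = hh H (ac g a) := by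
  refine cu_ext (f := ac g ∘ₗ hh H) (g := hh H ∘ₗ ac g) ?_
  rintro ⟨k, σ⟩ h
  obtain ⟨τ, hτ⟩ := cn_exists hH h
  rw [LinearMap.comp_apply, LinearMap.comp_apply, ac, pu_single, hh, extS_single, extS_single,
    cS_eq hτ, pu_single]
  rw [cS_eq (τ := (tr g).comp τ)]
  intro x t
  show g +ᵥ τ _ = H (g +ᵥ _) t
  rw [hτ, eH _ _ (h x)]

lemma rh_ac {U : Set X} {H : X → unitInterval → X}
    (eH : ∀ (g : G), ∀ x ∈ U, ∀ t, H (g +ᵥ x) t = g +ᵥ H x t) (g : G) :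
    ∀ a ∈ CU U, ac g (rh H a) = rh H (ac g a) := by
  refine cu_ext (f := ac g ∘ₗ rh H) (g := rh H ∘ₗ ac g) ?_
  rintro ⟨k, σ⟩ h
  rw [LinearMap.comp_apply, LinearMap.comp_apply, ac, pu_single, rh, extS_single, extS_single]
  dsimp only
  split_ifs
  · rw [pu_single]
    congr 2
    ext x
    exact (eH g _ (h _) 1).symm
  · simp

variable {ω : AddChar G ℚ}

lemma FF_hh {U : Set X} {H : X → unitInterval → X} (hH : Cn U H)
    (eH : ∀ (g : G), ∀ x ∈ U, ∀ t, H (g +ᵥ x) t = g +ᵥ H x t) :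
    ∀ a ∈ FF ω U, hh H a ∈ FF ω U := fun a ha =>
  ⟨hh_mem hH _ ha.1, fun g => by rw [hh_ac hH eH g _ ha.1, ha.2, map_smul]⟩

lemma FF_rh {U : Set X} {H : X → unitInterval → X} (hH : Cn U H)
    (eH : ∀ (g : G), ∀ x ∈ U, ∀ t, H (g +ᵥ x) t = g +ᵥ H x t) :
    ∀ a ∈ FF ω U, rh H a ∈ FF ω U := fun a ha =>
  ⟨rh_mem hH _ ha.1, fun g => by rw [rh_ac eH g _ ha.1, ha.2, map_smul]⟩

lemma acy_of_cone {U : Set X} {H : X → unitInterval → X} (hH : Cn U H)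
    (eH : ∀ (g : G), ∀ x ∈ U, ∀ t, H (g +ᵥ x) t = g +ᵥ H x t) (g0 : G) (hg : ω g0 ≠ 1)
    (fx : ∀ x ∈ U, g0 +ᵥ H x 1 = H x 1) : Acy ω U := by
  refine Rel.bot_of dd_dd fun b hb hdb => ⟨hh H b, FF_hh hH eH b hb, ?_⟩
  have h1 := hh_dd hH b hb.1
  rw [hdb, map_zero, add_zero] at h1
  have h2 : ∀ a ∈ CU U, ac g0 (rh H a) = rh H a := by
    refine cu_ext (f := ac g0 ∘ₗ rh H) (g := rh H) ?_
    rintro ⟨k, σ⟩ h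
    rw [LinearMap.comp_apply, rh, extS_single]
    dsimp only
    split_ifs
    · rw [ac, pu_single]
      congr 2
      ext x
      exact fx _ (h _)
    · simp
  have h3 := (FF_rh hH eH b hb).2 g0
  rw [h2 b hb.1] at h3
  have h4 : (ω g0 - 1) • rh H b = 0 := by rw [sub_smul, one_smul, ← h3, sub_self]
  rcases smul_eq_zero.1 h4 with h | h
  · exact absurd (sub_eq_zero.1 h) hg
  · rw [h1, h, sub_zero]

/-- point as a zero chain -/
noncomputable def pt (x : X) : SC X := Finsupp.single ⟨0, ContinuousMap.const _ x⟩ 1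

lemma ac_pt (g : G) (x : X) : ac g (pt x) = pt (g +ᵥ x) := by
  rw [pt, ac, pu_single]; rfl

lemma pj_ac (g : G) (a : SC X) : pj ω (ac g a) = ω g • pj ω a := by
  rw [pj_apply, pj_apply, smul_comm]
  congr 1
  rw [Finset.smul_sum, ← Equiv.sum_comp (Equiv.subRight g)]
  refine Finset.sum_congr rfl fun h _ => ?_
  rw [Equiv.subRight_apply, ← ac_add, smul_smul, ← AddChar.map_add_eq_mul,
    show -(h - g) = g + -h by abel, show (h - g) + g = h by abel]

lemma rh_pt {H : X → unitInterval → X} (x : X) : rh H (pt x) = pt (H x 1) := by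
  rw [pt, rh, extS_single, if_pos rfl]; rfl

lemma pt_mem {U : Set X} {x : X} (hx : x ∈ U) : pt x ∈ CU U := single_mem_CU fun _ => hx

lemma dd_pt (x : X) : dd (pt x) = 0 := by rw [pt, dd, extS_single, dS]

lemma pj_dd (a : SC X) : dd (pj ω a) = pj ω (dd a) := by
  simp only [pj_apply, map_smul, map_sum]
  simp only [ac, pu_dd]

lemma pr_pt (x : X) : pr 0 (pt x) = pt x := by rw [pt, pr_single, if_pos rfl]

lemma pj_pr (k : ℕ) (a : SC X) : pr k (pj ω a) = pj ω (pr k a) := by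
  simp only [pj_apply, map_smul, map_sum]
  simp only [ac, pu_pr]

lemma sph_of_cone {U : Set X} {H : X → unitInterval → X} (hH : Cn U H) (iU : Inv G U)
    (eH : ∀ (g : G), ∀ x ∈ U, ∀ t, H (g +ᵥ x) t = g +ᵥ H x t) {x0 : X} (hx0 : x0 ∈ U)
    (orb : ∀ x ∈ U, ∃ g : G, H x 1 = g +ᵥ H x0 1)
    (ε : X → ℚ) (hε : IsLocallyConstant fun x : U => ε x)
    (eε : ∀ g : G, ε (g +ᵥ x0) = ω g) :
    Sph dd (FF ω U) (pj ω (pt x0)) := by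
  refine ⟨pj_mem iU (pt_mem hx0), by rw [pj_dd, dd_pt, map_zero], ?_, ?_⟩
  · intro a ha hda
    have h1 := hh_dd hH a ha.1
    rw [hda, map_zero, add_zero] at h1
    -- the projected end point
    have h2 : ∀ b ∈ CU U, ∃ q : ℚ, pj ω (rh H b) = q • pj ω (pt (H x0 1)) := by
      have : CU U ≤ (Submodule.span ℚ {pj ω (pt (H x0 1))}).comap (pj ω ∘ₗ rh H) := by
        refine CU_le ?_
        rintro ⟨k, σ⟩ h
        show pj ω (rh H (Finsupp.single _ 1)) ∈ Submodule.span ℚ {pj ω (pt (H x0 1))}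
        rw [rh, extS_single]
        dsimp only
        split_ifs
        · obtain ⟨g, hg⟩ := orb _ (h (vtx k 0))
          have : Finsupp.single (⟨0, ContinuousMap.const _ (H (σ (vtx k 0)) 1)⟩ : Sing X) (1 : ℚ) =
            ac g (pt (H x0 1)) := by rw [ac_pt, ← hg]; rfl
          rw [this, pj_ac]
          exact Submodule.smul_mem _ _ (Submodule.mem_span_singleton_self _)
        · simp
      intro b hb
      obtain ⟨q, hq⟩ := Submodule.mem_span_singleton.1 (this hb)
      exact ⟨q, hq.symm⟩
    obtain ⟨q, hq⟩ := h2 a ha.1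
    rw [pj_eq (FF_rh hH eH a ha)] at hq
    have h3 := hh_dd hH (pt x0) (pt_mem hx0)
    rw [dd_pt, map_zero, add_zero, rh_pt] at h3
    have h4 : pj ω (pt (H x0 1)) = pj ω (pt x0) - dd (pj ω (hh H (pt x0))) := by
      rw [pj_dd, h3, map_sub]; abel
    refine ⟨q, hh H a - q • pj ω (hh H (pt x0)), Submodule.sub_mem _ (FF_hh hH eH a ha)
      (Submodule.smul_mem _ _ (pj_mem iU (hh_mem hH _ (pt_mem hx0)))), ?_⟩
    rw [map_sub, map_smul, h1, hq, h4, smul_sub]; abel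
  · intro q c hc e
    let E : SC X →ₗ[ℚ] ℚ := extS fun s => if s.1 = 0 then ε (s.2 (vtx s.1 0)) else 0
    have hE : ∀ a ∈ CU U, E (dd a) = 0 := by
      refine cu_ext (f := E ∘ₗ dd) (g := 0) ?_
      rintro ⟨k, σ⟩ h
      rw [LinearMap.comp_apply, dd, extS_single]
      match k, σ, h with
      | 0, σ, h => simp [dS]
      | 1, σ, h =>
        simp only [dS, map_sum, map_smul, E, extS_single, if_true]
        rw [Fin.sum_univ_two]
        have := locconst_eq hε h (face 0 (vtx 0 0)) (face 1 (vtx 0 0))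
        simp only [ContinuousMap.comp_apply, this]
        simp
      | k + 2, σ, h =>
        simp only [dS, map_sum, map_smul, E, extS_single]
        simp
    have hEz : E (pj ω (pt x0)) = 1 := by
      rw [pj_apply, map_smul, map_sum]
      have : ∀ g : G, E (ω (-g) • ac g (pt x0)) = 1 := fun g => by
        rw [map_smul, ac_pt, pt]
        simp only [E, extS_single, if_true]
        rw [ContinuousMap.const_apply, eε, smul_eq_mul, ← AddChar.map_add_eq_mul, neg_add_cancel,
          AddChar.map_zero_eq_one]
      simp only [this, Finset.sum_const, Finset.card_univ]
      rw [nsmul_eq_mul, mul_one, smul_eq_mul, inv_mul_cancel₀]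
      exact Nat.cast_ne_zero.2 Fintype.card_ne_zero
    have := congrArg E e
    rw [hE c hc.1, map_smul, hEz] at this
    simpa using this

end Cone
end HC

set_option linter.unusedSectionVars false
namespace HC

/-! ### Part 5: geometry of the hexagon -/
section Hex

noncomputable def uu : ℂ →ₗ[ℝ] ℝ := Complex.reLm + (Real.sqrt 3)⁻¹ • Complex.imLm
noncomputable def ww : ℂ →ₗ[ℝ] ℝ := - Complex.reLm + (Real.sqrt 3)⁻¹ • Complex.imLm

lemma uu_apply (z : ℂ) : uu z = z.re + (Real.sqrt 3)⁻¹ * z.im := rfl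
lemma ww_apply (z : ℂ) : ww z = -z.re + (Real.sqrt 3)⁻¹ * z.im := rfl

lemma s3 : (Real.sqrt 3)⁻¹ * Real.sqrt 3 = 1 := inv_mul_cancel₀ (by positivity)
lemma s3' : Real.sqrt 3 = 3 * (Real.sqrt 3)⁻¹ := by
  have h := Real.mul_self_sqrt (show (0 : ℝ) ≤ 3 by norm_num)
  have := s3
  field_simp
  nlinarith

lemma uw_ext {z z' : ℂ} (h1 : uu z = uu z') (h2 : ww z = ww z') : z = z' := by
  rw [uu_apply, uu_apply] at h1
  rw [ww_apply, ww_apply] at h2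
  have hr : z.re = z'.re := by linarith
  have hi : (Real.sqrt 3)⁻¹ * z.im = (Real.sqrt 3)⁻¹ * z'.im := by linarith
  exact Complex.ext hr (mul_left_cancel₀ (by positivity) hi)

lemma hexVertex_one : hexVertex 1 = ⟨1 / 2, Real.sqrt 3 / 2⟩ := by
  have : (2 * Real.pi * Complex.I * (1 : ℕ) / 6 : ℂ) = ((Real.pi / 3 : ℝ) : ℂ) * Complex.I := by
    push_cast; ring
  rw [hexVertex, this]
  refine Complex.ext ?_ ?_
  · rw [Complex.exp_ofReal_mul_I_re, Real.cos_pi_div_three]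
  · rw [Complex.exp_ofReal_mul_I_im, Real.sin_pi_div_three]

lemma hexVertex_zero : hexVertex 0 = 1 := by simp [hexVertex]

lemma hexVertex_succ (k : ℕ) : hexVertex (k + 1) = hexVertex k * hexVertex 1 := by
  rw [hexVertex, hexVertex, hexVertex, ← Complex.exp_add]
  congr 1; push_cast; ring

lemma uu_succ (k : ℕ) : uu (hexVertex (k + 1)) = - ww (hexVertex k) := by
  rw [hexVertex_succ, hexVertex_one, uu_apply, ww_apply]
  simp only [Complex.mul_re, Complex.mul_im]
  linear_combination ((hexVertex k).re / 2) * s3 - ((hexVertex k).im / 2) * s3'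

lemma ww_succ (k : ℕ) : ww (hexVertex (k + 1)) = uu (hexVertex k) + ww (hexVertex k) := by
  rw [hexVertex_succ, hexVertex_one, uu_apply, ww_apply, ww_apply]
  simp only [Complex.mul_re, Complex.mul_im]
  linear_combination ((hexVertex k).re / 2) * s3 + ((hexVertex k).im / 2) * s3'

lemma hv0 : uu (hexVertex 0) = 1 ∧ ww (hexVertex 0) = -1 := by
  rw [hexVertex_zero, uu_apply, ww_apply]; simp
lemma hvs {k : ℕ} {a b : ℝ} (h : uu (hexVertex k) = a ∧ ww (hexVertex k) = b) :
    uu (hexVertex (k + 1)) = -b ∧ ww (hexVertex (k + 1)) = a + b := by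
  rw [uu_succ, ww_succ, h.1, h.2]; exact ⟨rfl, rfl⟩
lemma hv1 : uu (hexVertex 1) = 1 ∧ ww (hexVertex 1) = 0 := by simpa using hvs hv0
lemma hv2 : uu (hexVertex 2) = 0 ∧ ww (hexVertex 2) = 1 := by simpa using hvs hv1
lemma hv3 : uu (hexVertex 3) = -1 ∧ ww (hexVertex 3) = 1 := by simpa using hvs hv2
lemma hv4 : uu (hexVertex 4) = -1 ∧ ww (hexVertex 4) = 0 := by simpa using hvs hv3
lemma hv5 : uu (hexVertex 5) = 0 ∧ ww (hexVertex 5) = -1 := by simpa using hvs hv4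
lemma hv6 : uu (hexVertex 6) = 1 ∧ ww (hexVertex 6) = -1 := by simpa using hvs hv5

/-- supporting functionals of the edges -/
noncomputable def ll : Fin 6 → ℂ →ₗ[ℝ] ℝ := ![uu, uu + ww, ww, -uu, -(uu + ww), -ww]

lemma ll_le {z : ℂ} (hz : z ∈ Hexagon) (k : Fin 6) : ll k z ≤ 1 := by
  have : Hexagon ⊆ {z | ll k z ≤ 1} := by
    refine convexHull_min ?_ (convex_halfSpace_le (ll k).isLinear 1)
    rintro _ ⟨j, rfl⟩
    show ll k (hexVertex j) ≤ 1
    fin_cases j <;> fin_cases k <;>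
      simp [ll, hv0, hv1, hv2, hv3, hv4, hv5]
  exact this hz

lemma ll_segment {z : ℂ} (hz : z ∈ Hexagon) (k : Fin 6) :
    z ∈ segment ℝ (hexVertex (k : ℕ)) (hexVertex ((k : ℕ) + 1)) ↔ ll k z = 1 := by
  constructor
  · rintro ⟨a, b, ha, hb, hab, rfl⟩
    rw [map_add, map_smul, map_smul]
    have h1 : ll k (hexVertex (k : ℕ)) = 1 ∧ ll k (hexVertex ((k : ℕ) + 1)) = 1 := by
      fin_cases k <;> simp [ll, hv0, hv1, hv2, hv3, hv4, hv5, hv6]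
    rw [h1.1, h1.2]; simpa using hab
  · intro h
    have h0 := ll_le hz 0
    have h1 := ll_le hz 1
    have h2 := ll_le hz 2
    have h3 := ll_le hz 3
    have h4 := ll_le hz 4
    have h5 := ll_le hz 5
    simp only [ll, Matrix.cons_val, LinearMap.add_apply, LinearMap.neg_apply] at h0 h1 h2 h3 h4 h5
    fin_cases k <;>
      simp only [ll, Fin.zero_eta, Fin.mk_one, Fin.reduceFinMk, Matrix.cons_val,
        LinearMap.add_apply, LinearMap.neg_apply] at h
    · refine ⟨-ww z, 1 + ww z, by linarith, by linarith, by ring, uw_ext ?_ ?_⟩ <;>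
        simp only [map_add, map_smul, smul_eq_mul] <;>
        simp [hv0, hv1] <;> linarith
    · refine ⟨uu z, ww z, by linarith, by linarith, by linarith, uw_ext ?_ ?_⟩ <;>
        simp only [map_add, map_smul, smul_eq_mul] <;>
        simp [hv1, hv2]
    · refine ⟨1 + uu z, -uu z, by linarith, by linarith, by ring, uw_ext ?_ ?_⟩ <;>
        simp only [map_add, map_smul, smul_eq_mul] <;>
        simp [hv3, hv2] <;> linarith
    · refine ⟨ww z, 1 - ww z, by linarith, by linarith, by ring, uw_ext ?_ ?_⟩ <;>
        simp only [map_add, map_smul, smul_eq_mul] <;>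
        simp [hv3, hv4] <;> linarith
    · refine ⟨-uu z, -ww z, by linarith, by linarith, by linarith, uw_ext ?_ ?_⟩ <;>
        simp only [map_add, map_smul, smul_eq_mul] <;>
        simp [hv5, hv4]
    · refine ⟨1 - uu z, uu z, by linarith, by linarith, by ring, uw_ext ?_ ?_⟩ <;>
        simp only [map_add, map_smul, smul_eq_mul] <;>
        simp [hv5, hv6] <;> linarith

def adjH (j k : Fin 6) : Bool := j = k || j = k + 1 || k = j + 1

lemma ll_adj {z : ℂ} (hz : z ∈ Hexagon) {j k : Fin 6} (hj : ll j z = 1) (hk : ll k z = 1) :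
    adjH j k = true := by
  have h0 := ll_le hz 0
  have h1 := ll_le hz 1
  have h2 := ll_le hz 2
  have h3 := ll_le hz 3
  have h4 := ll_le hz 4
  have h5 := ll_le hz 5
  simp only [ll, Matrix.cons_val, LinearMap.add_apply, LinearMap.neg_apply] at h0 h1 h2 h3 h4 h5
  fin_cases j <;> fin_cases k <;> first
    | decide
    | (exfalso
       simp only [ll, Fin.zero_eta, Fin.mk_one, Fin.reduceFinMk, Matrix.cons_val,
        LinearMap.add_apply, LinearMap.neg_apply] at hj hk
       linarith)

lemma adjH_form : ∀ A : Finset (Fin 6), (∀ j ∈ A, ∀ k ∈ A, adjH j k = true) →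
    A = ∅ ∨ (∃ k, A = {k}) ∨ (∃ k, A = {k, k + 1}) := by decide

lemma hexVertex_mem (k : Fin 6) : hexVertex k ∈ Hexagon :=
  subset_convexHull ℝ _ ⟨k, rfl⟩

lemma hexVertex_mem' (k : Fin 6) : hexVertex (k + 1) ∈ Hexagon := by
  have h6 : hexVertex 6 = hexVertex 0 := uw_ext (by rw [hv6.1, hv0.1]) (by rw [hv6.2, hv0.2])
  fin_cases k
  · exact hexVertex_mem 1
  · exact hexVertex_mem 2
  · exact hexVertex_mem 3
  · exact hexVertex_mem 4
  · exact hexVertex_mem 5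
  · show hexVertex 6 ∈ _
    rw [h6]; exact hexVertex_mem 0

lemma hex_mid {z w : ℂ} (hz : z ∈ Hexagon) (hw : w ∈ Hexagon) :
    (1 / 2 : ℝ) • z + (1 / 2 : ℝ) • w ∈ Hexagon :=
  convex_convexHull ℝ _ hz hw (by norm_num) (by norm_num) (by norm_num)

lemma hex_center (A : Finset (Fin 6)) (hA : ∀ j ∈ A, ∀ k ∈ A, adjH j k = true) :
    ∃ z ∈ Hexagon, ∀ k, k ∈ A ↔ ll k z = 1 := by
  rcases adjH_form A hA with rfl | ⟨j, rfl⟩ | ⟨j, rfl⟩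
  · refine ⟨_, hex_mid (hexVertex_mem 0) (hexVertex_mem 3), fun k => ?_⟩
    rw [map_add, map_smul, map_smul]
    fin_cases k <;> simp [ll, hv0, hv3]
  · refine ⟨_, hex_mid (hexVertex_mem j) (hexVertex_mem' j), fun k => ?_⟩
    rw [map_add, map_smul, map_smul]
    fin_cases j <;> fin_cases k <;> simp [ll, hv0, hv1, hv2, hv3, hv4, hv5, hv6] <;> norm_num
  · refine ⟨_, hexVertex_mem' j, fun k => ?_⟩
    fin_cases j <;> fin_cases k <;> simp [ll, hv0, hv1, hv2, hv3, hv4, hv5, hv6] <;> norm_num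

end Hex
end HC

set_option linter.unusedSectionVars false
namespace HC

/-! ### Part 6: the polytope and the cover -/
section Cover
variable {n : ℕ}

abbrev GG (n : ℕ) : Type := Fin n → ZMod 2
abbrev Fc (n : ℕ) : Type := Fin 6 ⊕ (Fin (n - 2) × Bool)

/-- supporting functional of a facet -/
noncomputable def LL : Fc n → HexPrismPt n → ℝ
  | .inl k, p => ll k p.1
  | .inr (i, true), p => (p.2 i : ℝ)
  | .inr (i, false), p => -(p.2 i : ℝ)

/-- characteristic function -/
def chi : Fc n → GG n
  | .inl k => hexEdgeVal n k
  | .inr (i, _) => eVec n i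

def adjF : Fc n → Fc n → Prop
  | .inl j, .inl k => adjH j k = true
  | .inr (i, a), .inr (j, b) => i = j → a = b
  | _, _ => True

lemma LL_le (f : Fc n) (p : HexPrismPt n) : LL f p ≤ 1 := by
  rcases f with k | ⟨i, _ | _⟩
  · exact ll_le p.1.2 k
  · have := (p.2 i).2.1
    show -(p.2 i : ℝ) ≤ 1
    linarith
  · exact (p.2 i).2.2

lemma LL_cont (f : Fc n) : Continuous (LL f : HexPrismPt n → ℝ) := by
  rcases f with k | ⟨i, _ | _⟩
  · exact (ll k).continuous_of_finiteDimensional.comp (continuous_subtype_val.comp continuous_fst)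
  · show Continuous fun p : HexPrismPt n => -(p.2 i : ℝ)
    fun_prop
  · show Continuous fun p : HexPrismPt n => (p.2 i : ℝ)
    fun_prop

lemma LL_adj {p : HexPrismPt n} {f g : Fc n} (hf : LL f p = 1) (hg : LL g p = 1) : adjF f g := by
  rcases f with k | ⟨i, a⟩ <;> rcases g with l | ⟨j, b⟩
  · exact ll_adj p.1.2 hf hg
  · trivial
  · trivial
  · rintro rfl
    cases a <;> cases b <;> simp only [LL] at hf hg <;> first | rfl | (exfalso; linarith)

lemma gen_eq (p : HexPrismPt n) : hexGenSet n p = {v | ∃ f : Fc n, LL f p = 1 ∧ v = chi f} := by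
  ext v
  constructor
  · rintro (⟨i, h | h, rfl⟩ | ⟨k, h, rfl⟩)
    · exact ⟨.inr (i, false), by simp [LL, h], rfl⟩
    · exact ⟨.inr (i, true), by simp [LL, h], rfl⟩
    · exact ⟨.inl k, (ll_segment p.1.2 k).1 h, rfl⟩
  · rintro ⟨k | ⟨i, _ | _⟩, h, rfl⟩
    · exact Or.inr ⟨k, (ll_segment p.1.2 k).2 h, rfl⟩
    · simp only [LL] at h
      exact Or.inl ⟨i, Or.inl (by linarith), rfl⟩
    · exact Or.inl ⟨i, Or.inr h, rfl⟩

lemma center_exists (S : Finset (Fc n)) (hS : ∀ f ∈ S, ∀ g ∈ S, adjF f g) :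
    ∃ c : HexPrismPt n, ∀ f, f ∈ S ↔ LL f c = 1 := by
  classical
  obtain ⟨z, hz, h⟩ := hex_center (Finset.univ.filter fun k => (.inl k : Fc n) ∈ S) (by
    intro j hj k hk
    simp only [Finset.mem_filter, Finset.mem_univ, true_and] at hj hk
    exact hS _ hj _ hk)
  refine ⟨(⟨z, hz⟩, fun i => if (.inr (i, true) : Fc n) ∈ S then ⟨1, by norm_num⟩ else
    if (.inr (i, false) : Fc n) ∈ S then ⟨-1, by norm_num⟩ else ⟨0, by norm_num⟩), ?_⟩
  rintro (k | ⟨i, b⟩)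
  · have h' := h k
    simp only [Finset.mem_filter, Finset.mem_univ, true_and] at h'
    exact h'
  · have hx : ¬ ((.inr (i, true) : Fc n) ∈ S ∧ (.inr (i, false) : Fc n) ∈ S) := by
      rintro ⟨h1, h2⟩
      exact absurd (hS _ h1 _ h2 rfl) (by decide)
    by_cases h1 : (.inr (i, true) : Fc n) ∈ S <;> by_cases h2 : (.inr (i, false) : Fc n) ∈ S <;>
      cases b <;> simp [LL, h1, h2] <;> first | (exfalso; exact hx (And.intro h1 h2)) | norm_num

/-- straight line contraction -/
noncomputable def cc (p q : HexPrismPt n) (t : unitInterval) : HexPrismPt n :=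
  (⟨(1 - (t : ℝ)) • (p.1 : ℂ) + (t : ℝ) • (q.1 : ℂ), convex_convexHull ℝ _ p.1.2 q.1.2
      (sub_nonneg.2 t.2.2) t.2.1 (by ring)⟩,
    fun i => ⟨(1 - (t : ℝ)) • (p.2 i : ℝ) + (t : ℝ) • (q.2 i : ℝ), convex_Icc (-1 : ℝ) 1 (p.2 i).2
      (q.2 i).2 (sub_nonneg.2 t.2.2) t.2.1 (by ring)⟩)

lemma cc_zero (p q : HexPrismPt n) : cc p q 0 = p := by
  refine Prod.ext (Subtype.ext ?_) (funext fun i => Subtype.ext ?_) <;> simp [cc]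
lemma cc_one (p q : HexPrismPt n) : cc p q 1 = q := by
  refine Prod.ext (Subtype.ext ?_) (funext fun i => Subtype.ext ?_) <;> simp [cc]

lemma cc_cont (q : HexPrismPt n) :
    Continuous fun x : HexPrismPt n × unitInterval => cc x.1 q x.2 := by
  unfold cc
  fun_prop

lemma LL_cc (f : Fc n) (p q : HexPrismPt n) (t : unitInterval) :
    LL f (cc p q t) = (1 - (t : ℝ)) * LL f p + t * LL f q := by
  rcases f with k | ⟨i, _ | _⟩
  · show ll k _ = _
    simp only [cc, map_add, map_smul, smul_eq_mul]; rfl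
  · simp only [cc, LL, smul_eq_mul]; ring
  · simp only [cc, LL, smul_eq_mul]

/-- class of a point -/
def mk (g : GG n) (p : HexPrismPt n) : HexCover n := Quot.mk _ (g, p)

lemma gg_two (g : GG n) : g + g = 0 := by
  funext i; exact CharTwo.add_self_eq_zero _

lemma rel_symm {a b : GG n} {V : Submodule (ZMod 2) (GG n)} (h : a + b ∈ V) : b + a ∈ V := by
  rwa [add_comm]

lemma rel_equiv (n : ℕ) : Equivalence (hexCoverRel n) where
  refl x := ⟨rfl, by rw [gg_two]; exact Submodule.zero_mem _⟩
  symm {x y} h := ⟨h.1.symm, by rw [← h.1, add_comm]; exact h.2⟩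
  trans {x y z} h1 h2 := ⟨h1.1.trans h2.1, by
    have h3 := h2.2
    rw [← h1.1] at h3
    have := Submodule.add_mem _ h1.2 h3
    rwa [show x.1 + y.1 + (y.1 + z.1) = x.1 + z.1 + (y.1 + y.1) by abel, gg_two, add_zero] at this⟩

lemma mk_eq {g h : GG n} {p q : HexPrismPt n} :
    mk g p = mk h q ↔ p = q ∧ g + h ∈ Submodule.span (ZMod 2) (hexGenSet n p) := by
  constructor
  · intro e
    have := Quot.eqvGen_exact e
    rw [(rel_equiv n).eqvGen_iff] at this
    exact this
  · intro h
    exact Quot.sound h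

lemma mk_quot : Topology.IsQuotientMap (fun x : GG n × HexPrismPt n => mk x.1 x.2) :=
  isQuotientMap_quot_mk

/-- projection to the polytope -/
def prj : HexCover n → HexPrismPt n := Quot.lift (fun x => x.2) fun _ _ h => h.1

@[simp] lemma prj_mk (g : GG n) (p : HexPrismPt n) : prj (mk g p) = p := rfl

lemma prj_cont : Continuous (prj : HexCover n → HexPrismPt n) := by
  rw [mk_quot.continuous_iff]; exact continuous_snd

/-- a group coordinate -/
noncomputable def gc (x : HexCover n) : GG n := (Quot.out x).1

lemma mk_gc (x : HexCover n) : mk (gc x) (prj x) = x := by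
  have h : mk (Quot.out x).1 (Quot.out x).2 = x := Quot.out_eq x
  have h2 : prj x = (Quot.out x).2 := by conv_lhs => rw [← h, prj_mk]
  rw [h2]; exact h

lemma mk_surj (x : HexCover n) : ∃ g p, x = mk g p := ⟨_, _, (mk_gc x).symm⟩

noncomputable instance : AddAction (GG n) (HexCover n) where
  vadd g := Quot.map (fun x => (g + x.1, x.2)) fun a b h => ⟨h.1, by
    have : g + a.1 + (g + b.1) = a.1 + b.1 := by
      rw [show g + a.1 + (g + b.1) = a.1 + b.1 + (g + g) by abel, gg_two, add_zero]
    show g + a.1 + (g + b.1) ∈ _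
    rw [this]; exact h.2⟩
  zero_vadd x := by
    obtain ⟨g, p, rfl⟩ := mk_surj x
    show mk (0 + g) p = _
    rw [zero_add]
  add_vadd g h x := by
    obtain ⟨k, p, rfl⟩ := mk_surj x
    show mk (g + h + k) p = mk (g + (h + k)) p
    rw [add_assoc]

lemma vadd_mk (g h : GG n) (p : HexPrismPt n) : g +ᵥ mk h p = mk (g + h) p := rfl

instance : ContinuousConstVAdd (GG n) (HexCover n) where
  continuous_const_vadd g := by
    rw [mk_quot.continuous_iff]
    have : Continuous fun x : GG n × HexPrismPt n => (g + x.1, x.2) := by fun_prop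
    exact mk_quot.continuous.comp this

/-- points whose facets lie in `T` -/
def XS (T : Finset (Fc n)) : Set (HexCover n) := {x | ∀ f, LL f (prj x) = 1 → f ∈ T}

lemma XS_open (T : Finset (Fc n)) : IsOpen (XS T) := by
  have : XS T = ⋂ f : Fc n, {x | f ∈ T ∨ LL f (prj x) < 1} := by
    ext x
    simp only [XS, Set.mem_iInter]
    refine forall_congr' fun f => ?_
    have := LL_le f (prj x)
    constructor
    · intro h
      rcases this.lt_or_eq with h' | h'
      · exact Or.inr h'
      · exact Or.inl (h h')
    · rintro (h | h)
      · exact fun _ => h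
      · intro h'; exact absurd h' h.ne
  rw [this]
  refine isOpen_iInter_of_finite fun f => ?_
  by_cases hf : f ∈ T
  · have : {x : HexCover n | f ∈ T ∨ LL f (prj x) < 1} = Set.univ := by
      ext x; simp [hf]
    rw [this]; exact isOpen_univ
  · have : {x : HexCover n | f ∈ T ∨ LL f (prj x) < 1} = {x | LL f (prj x) < 1} := by
      ext x; simp [hf]
    rw [this]; exact isOpen_lt ((LL_cont f).comp prj_cont) continuous_const

lemma prj_vadd (g : GG n) (x : HexCover n) : prj (g +ᵥ x) = prj x := by
  obtain ⟨h, p, rfl⟩ := mk_surj x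
  rfl

lemma XS_inv (T : Finset (Fc n)) : Inv (GG n) (XS T) := by
  intro g x hx f hf
  rw [prj_vadd] at hf
  exact hx f hf

lemma XS_inter [DecidableEq (Fc n)] (S T : Finset (Fc n)) : XS (S ∩ T) = XS S ∩ XS T := by
  ext x
  constructor
  · intro h
    exact ⟨fun f hf => (Finset.mem_inter.1 (h f hf)).1, fun f hf => (Finset.mem_inter.1 (h f hf)).2⟩
  · rintro ⟨h1, h2⟩ f hf
    exact Finset.mem_inter.2 ⟨h1 f hf, h2 f hf⟩

lemma XS_mono {S T : Finset (Fc n)} (h : S ⊆ T) : XS S ⊆ XS T := fun _ hx f hf => h (hx f hf)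

/-- the contraction -/
noncomputable def Hc (c : HexPrismPt n) (x : HexCover n) (t : unitInterval) : HexCover n :=
  mk (gc x) (cc (prj x) c t)

lemma Hc_mk {S : Finset (Fc n)} {c : HexPrismPt n} (hc : ∀ f, f ∈ S ↔ LL f c = 1)
    {g : GG n} {p : HexPrismPt n} (h : mk g p ∈ XS S) (t : unitInterval) :
    Hc c (mk g p) t = mk g (cc p c t) := by
  rw [Hc, prj_mk, mk_eq]
  refine ⟨rfl, ?_⟩
  have h1 := (mk_eq.1 (mk_gc (mk g p))).2
  rw [prj_mk] at h1
  refine Submodule.span_mono ?_ h1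
  rw [gen_eq, gen_eq]
  rintro _ ⟨f, hf, rfl⟩
  refine ⟨f, ?_, rfl⟩
  rw [LL_cc, hf, (hc f).1 (h f hf)]; ring

lemma ind_quot (S : Finset (Fc n)) :
    Topology.IsQuotientMap ((XS S).restrictPreimage fun x : GG n × HexPrismPt n => mk x.1 x.2) :=
  mk_quot.restrictPreimage_isOpen (XS_open S)

lemma Hc_cn {S : Finset (Fc n)} {c : HexPrismPt n} (hc : ∀ f, f ∈ S ↔ LL f c = 1) :
    Cn (XS S) (Hc c) where
  cont := by
    have h1 : ∀ x : XS S, Continuous fun t => Hc c x t := by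
      rintro ⟨x, hx⟩
      obtain ⟨g, p, rfl⟩ := mk_surj x
      simp only [Hc_mk hc hx]
      refine mk_quot.continuous.comp (f := fun t => (g, cc p c t)) ?_
      exact continuous_const.prodMk
        ((cc_cont c).comp (f := fun t => (p, t)) (continuous_const.prodMk continuous_id))
    let F : XS S → C(unitInterval, HexCover n) := fun x => ⟨fun t => Hc c x t, h1 x⟩
    have hF : Continuous F := by
      rw [(ind_quot S).continuous_iff]
      let D := ((fun x : GG n × HexPrismPt n => mk x.1 x.2) ⁻¹' XS S : Set (GG n × HexPrismPt n))
      have h2 : Continuous fun x : D × unitInterval => (mk x.1.1.1 (cc x.1.1.2 c x.2) : HexCover n) := by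
        refine mk_quot.continuous.comp
          (f := fun x : D × unitInterval => (x.1.1.1, cc x.1.1.2 c x.2)) ?_
        refine Continuous.prodMk (by fun_prop) ?_
        exact (cc_cont c).comp (f := fun x : D × unitInterval => (x.1.1.2, x.2)) (by fun_prop)
      let F2 : C(D × unitInterval, HexCover n) := ⟨_, h2⟩
      refine (F2.curry.continuous).congr fun x => ?_
      ext t
      exact (Hc_mk hc x.2 t).symm
    exact ContinuousMap.continuous_uncurry_of_continuous ⟨F, hF⟩
  zero := by
    intro x hx
    rw [Hc, cc_zero, mk_gc]
  mem := by
    intro x hx t f hf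
    rw [Hc, prj_mk, LL_cc] at hf
    have h1 := LL_le f (prj x)
    have h2 := LL_le f c
    by_contra hn
    have h3 : LL f (prj x) < 1 := lt_of_le_of_ne h1 fun h => hn (hx f h)
    have h4 : LL f c < 1 := lt_of_le_of_ne h2 fun h => hn ((hc f).2 h)
    have h5 := t.2.1
    have h6 := t.2.2
    rcases h5.eq_or_lt with h | h
    · rw [← h] at hf; linarith
    · nlinarith
  loc := by
    intro s
    rw [← (ind_quot S).isOpen_preimage]
    have : (XS S).restrictPreimage (fun x : GG n × HexPrismPt n => mk x.1 x.2) ⁻¹'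
        ((fun x : XS S => Hc c x 1) ⁻¹' s) =
        (fun x : ((fun x : GG n × HexPrismPt n => mk x.1 x.2) ⁻¹' XS S : Set (GG n × HexPrismPt n)) =>
          x.1.1) ⁻¹' {g | mk g c ∈ s} := by
      ext x
      show Hc c (mk x.1.1 x.1.2) 1 ∈ s ↔ mk x.1.1 c ∈ s
      rw [Hc_mk hc x.2, cc_one]
    rw [this]
    exact (isOpen_discrete _).preimage (by fun_prop)

lemma Hc_eq {S : Finset (Fc n)} {c : HexPrismPt n} (hc : ∀ f, f ∈ S ↔ LL f c = 1) :
    ∀ (g : GG n), ∀ x ∈ XS S, ∀ t, Hc c (g +ᵥ x) t = g +ᵥ Hc c x t := by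
  intro g x hx t
  obtain ⟨h, p, rfl⟩ := mk_surj x
  have hx' := XS_inv S g _ hx
  rw [vadd_mk] at hx' ⊢
  rw [Hc_mk hc hx, Hc_mk hc hx', vadd_mk]

variable {ω : AddChar (GG n) ℚ}

lemma acy_XS {S : Finset (Fc n)} (hS : ∀ f ∈ S, ∀ g ∈ S, adjF f g) {f : Fc n} (hf : f ∈ S)
    (hω : ω (chi f) ≠ 1) : Acy ω (XS S) := by
  obtain ⟨c, hc⟩ := center_exists S hS
  refine acy_of_cone (Hc_cn hc) (Hc_eq hc) (chi f) hω ?_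
  intro x hx
  obtain ⟨h, p, rfl⟩ := mk_surj x
  rw [Hc_mk hc hx, cc_one, vadd_mk, mk_eq]
  refine ⟨rfl, ?_⟩
  rw [add_assoc, gg_two, add_zero]
  refine Submodule.subset_span ?_
  rw [gen_eq]
  exact ⟨f, (hc f).1 hf, rfl⟩

lemma om_span {p : HexPrismPt n} (h : ∀ f, LL f p = 1 → ω (chi f) = 1) {v : GG n}
    (hv : v ∈ Submodule.span (ZMod 2) (hexGenSet n p)) : ω v = 1 := by
  induction hv using Submodule.span_induction with
  | mem x hx =>
    rw [gen_eq] at hx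
    obtain ⟨f, hf, rfl⟩ := hx
    exact h f hf
  | zero => exact AddChar.map_zero_eq_one ω
  | add x y _ _ hx hy => rw [AddChar.map_add_eq_mul, hx, hy, one_mul]
  | smul a x _ hx =>
    have ha : a = 0 ∨ a = 1 := by revert a; decide
    rcases ha with rfl | rfl
    · rw [zero_smul, AddChar.map_zero_eq_one]
    · rw [one_smul, hx]

/-- center of the polytope -/
noncomputable def p0 (n : ℕ) : HexPrismPt n :=
  (center_exists (∅ : Finset (Fc n)) (by simp)).choose

lemma p0_spec (f : Fc n) : LL f (p0 n) ≠ 1 := by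
  have := (center_exists (∅ : Finset (Fc n)) (by simp)).choose_spec f
  intro h
  have h' := this.2 h
  simp at h'

/-- base class -/
noncomputable def z0 (ω : AddChar (GG n) ℚ) : SC (HexCover n) := pj ω (pt (mk 0 (p0 n)))

lemma sph_XS {S : Finset (Fc n)} (hS : ∀ f ∈ S, ∀ g ∈ S, adjF f g)
    (hω : ∀ f ∈ S, ω (chi f) = 1) : Sph dd (FF ω (XS S)) (z0 ω) := by
  obtain ⟨c, hc⟩ := center_exists S hS
  have m0 : ∀ g, mk g (p0 n) ∈ XS S := fun g f hf => absurd hf (p0_spec f)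
  have hg : ∀ g p, mk g p ∈ XS S → ω (gc (mk g p)) = ω g := by
    intro g p h
    have h1 := (mk_eq.1 (mk_gc (mk g p))).2
    rw [prj_mk] at h1
    have h2 := om_span (ω := ω) (fun f hf => hω f (h f hf)) h1
    rw [AddChar.map_add_eq_mul] at h2
    have h3 : ω g * ω g = 1 := by
      rw [← AddChar.map_add_eq_mul, gg_two, AddChar.map_zero_eq_one]
    calc ω (gc (mk g p)) = ω (gc (mk g p)) * ω g * ω g := by rw [mul_assoc, h3, mul_one]
      _ = ω g := by rw [h2, one_mul]
  refine sph_of_cone (Hc_cn hc) (XS_inv S) (Hc_eq hc) (m0 0) ?_ (fun x => ω (gc x)) ?_ ?_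
  · intro x hx
    obtain ⟨h, p, rfl⟩ := mk_surj x
    refine ⟨h, ?_⟩
    rw [Hc_mk hc hx, Hc_mk hc (m0 0), cc_one, cc_one, vadd_mk, add_zero]
  · intro s
    rw [← (ind_quot S).isOpen_preimage]
    have : (XS S).restrictPreimage (fun x : GG n × HexPrismPt n => mk x.1 x.2) ⁻¹'
        ((fun x : XS S => ω (gc (x : HexCover n))) ⁻¹' s) =
        (fun x : ((fun x : GG n × HexPrismPt n => mk x.1 x.2) ⁻¹' XS S : Set (GG n × HexPrismPt n)) =>
          x.1.1) ⁻¹' {g | ω g ∈ s} := by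
      ext x
      show ω (gc (mk x.1.1 x.1.2)) ∈ s ↔ ω x.1.1 ∈ s
      rw [hg _ _ x.2]
    rw [this]
    exact (isOpen_discrete _).preimage (by fun_prop)
  · intro g
    rw [vadd_mk, add_zero]
    exact hg _ _ (m0 g)

end Cover
end HC

set_option linter.unusedSectionVars false
namespace HC

/-! ### Part 7: combinatorics of facets -/
section Comb
variable {n : ℕ} {ω : AddChar (GG n) ℚ}

instance : DecidableEq (Fc n) := inferInstance

lemma adjF_self (f : Fc n) : adjF f f := by
  rcases f with k | ⟨i, b⟩
  · show adjH k k = true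
    simp [adjH]
  · exact fun _ => rfl

lemma adjF_symm {f g : Fc n} (h : adjF f g) : adjF g f := by
  rcases f with k | ⟨i, b⟩ <;> rcases g with l | ⟨j, c⟩
  · have h' : adjH k l = true := h
    show adjH l k = true
    clear h; revert k l; decide
  · trivial
  · trivial
  · exact fun e => (h e.symm).symm

/-- pairwise adjacent -/
def Cl (S : Finset (Fc n)) : Prop := ∀ f ∈ S, ∀ g ∈ S, adjF f g

lemma Cl.inter {S T : Finset (Fc n)} (h : Cl S) : Cl (S ∩ T) := fun f hf g hg =>
  h f (Finset.mem_inter.1 hf).1 g (Finset.mem_inter.1 hg).1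

open Classical in
/-- facets at a point -/
noncomputable def fac (p : HexPrismPt n) : Finset (Fc n) := Finset.univ.filter fun f => LL f p = 1

lemma mem_fac {p : HexPrismPt n} {f : Fc n} : f ∈ fac p ↔ LL f p = 1 := by simp [fac]

lemma fac_cl (p : HexPrismPt n) : Cl (fac p) := fun _ hf _ hg =>
  LL_adj (mem_fac.1 hf) (mem_fac.1 hg)

lemma mem_XS_fac (x : HexCover n) : x ∈ XS (fac (prj x)) := fun _ hf => mem_fac.2 hf

lemma fac_sub {x : HexCover n} {T : Finset (Fc n)} (h : x ∈ XS T) : fac (prj x) ⊆ T :=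
  fun f hf => h f (mem_fac.1 hf)

open Classical in
/-- facets on which the character is non-trivial -/
noncomputable def Lw (ω : AddChar (GG n) ℚ) : Finset (Fc n) :=
  Finset.univ.filter fun f => ω (chi f) ≠ 1

lemma mem_Lw {f : Fc n} : f ∈ Lw ω ↔ ω (chi f) ≠ 1 := by simp [Lw]

open Classical in
lemma rel_Lw : Rel dd (FF ω (XS (Lw ω))) (FF ω (Set.univ : Set (HexCover n))) := by
  have key := rel_UL (G := GG n) (ω := ω) (a := fun S : Finset (Fc n) => XS (S ∩ Lw ω)) (b := fun S => XS S)
    (fun S => XS_open _) (fun S => XS_open _) (fun S => XS_inv _) (fun S => XS_inv _)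
    (fun S T => by
      show XS (S ∩ T ∩ Lw ω) = _
      rw [← XS_inter, Finset.inter_inter_distrib_right]) (fun S T => XS_inter S T)
    (fun S => XS_mono Finset.inter_subset_left) (K := Cl) (fun S T hS _ => hS.inter)
    (fun S hS => by
      by_cases h : ∃ f ∈ S, ω (chi f) ≠ 1
      · obtain ⟨f, hf, hw⟩ := h
        exact Rel.of_acyclic dd_dd (FF_mono (XS_mono Finset.inter_subset_left))
          (acy_XS hS.inter (Finset.mem_inter.2 ⟨hf, mem_Lw.2 hw⟩) hw) (acy_XS hS hf hw)
      · push Not at h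
        exact Rel.of_sph dd_dd (FF_mono (XS_mono Finset.inter_subset_left))
          (sph_XS hS.inter fun f hf => h f (Finset.mem_inter.1 hf).1) (sph_XS hS h))
    ((Finset.univ : Finset (Finset (Fc n))).filter Cl).toList
    (fun S hS => by simpa using hS)
  have h1 : UL (fun S : Finset (Fc n) => XS (S ∩ Lw ω))
      ((Finset.univ : Finset (Finset (Fc n))).filter Cl).toList = XS (Lw ω) := by
    ext x
    constructor
    · rintro ⟨S, _, hx⟩
      exact XS_mono Finset.inter_subset_right hx
    · intro hx
      refine ⟨fac (prj x), by simpa using fac_cl _, ?_⟩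
      show x ∈ XS (fac (prj x) ∩ Lw ω)
      rw [XS_inter]
      exact ⟨mem_XS_fac x, hx⟩
  have h2 : UL (fun S : Finset (Fc n) => XS S)
      ((Finset.univ : Finset (Finset (Fc n))).filter Cl).toList = Set.univ := by
    refine Set.eq_univ_of_forall fun x => ⟨fac (prj x), by simpa using fac_cl _, mem_XS_fac x⟩
  rwa [h1, h2] at key

lemma FF_empty : FF ω (∅ : Set (HexCover n)) = ⊥ := by
  rw [eq_bot_iff]
  intro a ha
  exact (CU_le (U := (∅ : Set (HexCover n))) (B := ⊥) fun s hs => absurd (hs (vtx s.1 0)) (by simp)) ha.1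

open Classical in
lemma acy_cone {T : Finset (Fc n)} (hT : ∀ f ∈ T, ω (chi f) ≠ 1) {f : Fc n} (hf : f ∈ T)
    (had : ∀ g ∈ T, adjF f g) : Acy ω (XS T) := by
  have key := rel_UL (G := GG n) (ω := ω) (a := fun _ : Finset (Fc n) => ∅) (b := fun S => XS S)
    (fun S => isOpen_empty) (fun S => XS_open _) (fun S g x hx => hx) (fun S => XS_inv _)
    (fun S T => by simp) (fun S T => XS_inter S T)
    (fun S => Set.empty_subset _) (K := fun S => Cl S ∧ f ∈ S ∧ S ⊆ T)
    (fun S S' hS hS' => ⟨hS.1.inter, Finset.mem_inter.2 ⟨hS.2.1, hS'.2.1⟩,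
      Finset.inter_subset_left.trans hS.2.2⟩)
    (fun S hS => by
      rw [FF_empty]
      exact acy_XS hS.1 hS.2.1 (hT f hf))
    ((Finset.univ : Finset (Finset (Fc n))).filter fun S => Cl S ∧ f ∈ S ∧ S ⊆ T).toList
    (fun S hS => by simpa using hS)
  have h1 : UL (fun _ : Finset (Fc n) => (∅ : Set (HexCover n)))
      ((Finset.univ : Finset (Finset (Fc n))).filter fun S => Cl S ∧ f ∈ S ∧ S ⊆ T).toList = ∅ := by
    ext x; simp [UL]
  have h2 : UL (fun S : Finset (Fc n) => XS S)
      ((Finset.univ : Finset (Finset (Fc n))).filter fun S => Cl S ∧ f ∈ S ∧ S ⊆ T).toList = XS T := by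
    ext x
    constructor
    · rintro ⟨S, hS, hx⟩
      simp only [Finset.mem_toList, Finset.mem_filter, Finset.mem_univ, true_and] at hS
      exact XS_mono hS.2.2 hx
    · intro hx
      refine ⟨insert f (fac (prj x)), ?_, XS_mono (Finset.subset_insert _ _) (mem_XS_fac x)⟩
      simp only [Finset.mem_toList, Finset.mem_filter, Finset.mem_univ, true_and]
      refine ⟨?_, Finset.mem_insert_self _ _, Finset.insert_subset hf (fac_sub hx)⟩
      intro g hg g' hg'
      rcases Finset.mem_insert.1 hg with e1 | h1' <;> rcases Finset.mem_insert.1 hg' with e2 | h2'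
      · rw [e1, e2]; exact adjF_self _
      · rw [e1]; exact had _ (fac_sub hx h2')
      · rw [e2]; exact adjF_symm (had _ (fac_sub hx h1'))
      · exact fac_cl _ _ h1' _ h2'
  rw [h1, h2, FF_empty] at key
  exact key

lemma XS_union {T T1 T2 : Finset (Fc n)} (h1 : T1 ⊆ T) (h2 : T2 ⊆ T)
    (h : ∀ f ∈ T, f ∉ T1 → ∀ g ∈ T, g ∉ T2 → ¬ adjF f g) : XS T = XS T1 ∪ XS T2 := by
  ext x
  constructor
  · intro hx
    by_contra hn
    rw [Set.mem_union, not_or] at hn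
    obtain ⟨ha, hb⟩ := hn
    simp only [XS, Set.mem_ofPred_eq] at ha hb
    push Not at ha hb
    obtain ⟨f, hf, hf'⟩ := ha
    obtain ⟨g, hg, hg'⟩ := hb
    exact h f (hx f hf) hf' g (hx g hg) hg' (LL_adj hf hg)
  · rintro (hx | hx)
    · exact XS_mono h1 hx
    · exact XS_mono h2 hx

lemma susp {T T1 T2 T12 : Finset (Fc n)} (h1 : T1 ⊆ T) (h2 : T2 ⊆ T)
    (h : ∀ f ∈ T, f ∉ T1 → ∀ g ∈ T, g ∉ T2 → ¬ adjF f g) (h12 : T1 ∩ T2 = T12)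
    (a1 : Acy ω (XS T1)) (a2 : Acy ω (XS T2)) {k : ℕ} (hs : SphD ω (XS T12) k) :
    SphD ω (XS T) (k + 1) := by
  rw [XS_union h1 h2 h]
  refine SphD.susp (XS_open _) (XS_open _) (XS_inv _) (XS_inv _) a1 a2 ?_
  rw [← XS_inter, h12]; exact hs

lemma acyU {T T1 T2 T12 : Finset (Fc n)} (h1 : T1 ⊆ T) (h2 : T2 ⊆ T)
    (h : ∀ f ∈ T, f ∉ T1 → ∀ g ∈ T, g ∉ T2 → ¬ adjF f g) (h12 : T1 ∩ T2 = T12)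
    (a1 : Acy ω (XS T1)) (a2 : Acy ω (XS T2)) (hs : Acy ω (XS T12)) :
    Acy ω (XS T) := by
  rw [XS_union h1 h2 h]
  refine Acy.union (XS_open _) (XS_open _) (XS_inv _) (XS_inv _) a1 a2 ?_
  rw [← XS_inter, h12]; exact hs

/-- hexagon part `A`, cube part `B` -/
def LS (A : Finset (Fin 6)) (B : Finset (Fin (n - 2))) : Finset (Fc n) :=
  A.disjSum (B ×ˢ Finset.univ)

lemma inl_LS {A : Finset (Fin 6)} {B : Finset (Fin (n - 2))} {k : Fin 6} :
    (.inl k : Fc n) ∈ LS A B ↔ k ∈ A := by simp [LS]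
lemma inr_LS {A : Finset (Fin 6)} {B : Finset (Fin (n - 2))} {i : Fin (n - 2)} {b : Bool} :
    (.inr (i, b) : Fc n) ∈ LS A B ↔ i ∈ B := by simp [LS]

lemma LS_mono {A A' : Finset (Fin 6)} (h : A ⊆ A') : LS A (∅ : Finset (Fin (n - 2))) ⊆ LS A' ∅ := by
  rintro (k | ⟨i, b⟩) hf
  · exact inl_LS.2 (h (inl_LS.1 hf))
  · simp [inr_LS] at hf

lemma LS_inter {A A' : Finset (Fin 6)} :
    LS A (∅ : Finset (Fin (n - 2))) ∩ LS A' ∅ = LS (A ∩ A') ∅ := by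
  ext (k | ⟨i, b⟩) <;> simp [inl_LS, inr_LS]

lemma LS_sep {A A1 A2 : Finset (Fin 6)} (h : ∀ j ∈ A, j ∉ A1 → ∀ k ∈ A, k ∉ A2 → ¬ adjH j k = true) :
    ∀ f ∈ LS A (∅ : Finset (Fin (n - 2))), f ∉ LS A1 (∅ : Finset (Fin (n - 2))) →
    ∀ g ∈ LS A (∅ : Finset (Fin (n - 2))), g ∉ LS A2 (∅ : Finset (Fin (n - 2))) → ¬ adjF f g := by
  rintro (j | ⟨i, b⟩) hf hf' (k | ⟨i', b'⟩) hg hg'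
  · rw [inl_LS] at hf hf' hg hg'
    exact h j hf hf' k hg hg'
  all_goals simp [inr_LS] at hf hg

lemma cube_susp {A : Finset (Fin 6)} {B : Finset (Fin (n - 2))} (i : Fin (n - 2)) (hi : i ∉ B)
    (hT : ∀ f ∈ LS A (insert i B), ω (chi f) ≠ 1) {k : ℕ} (h : SphD ω (XS (LS A B)) k) :
    SphD ω (XS (LS A (insert i B))) (k + 1) := by
  have hsub : ∀ b : Bool, (LS A (insert i B)).erase (.inr (i, b)) ⊆ LS A (insert i B) :=
    fun b => Finset.erase_subset _ _
  have hac : ∀ b : Bool, Acy ω (XS ((LS A (insert i B)).erase (.inr (i, b)))) := by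
    intro b
    refine acy_cone (f := .inr (i, !b)) (fun f hf => hT f (hsub b hf)) ?_ ?_
    · rw [Finset.mem_erase, inr_LS]
      refine ⟨by simp, Finset.mem_insert_self _ _⟩
    · rintro (k | ⟨j, c⟩) hg
      · trivial
      · rintro rfl
        rw [Finset.mem_erase] at hg
        have : c ≠ b := fun e => hg.1 (by rw [e])
        revert this; cases b <;> cases c <;> simp
  refine susp (hsub true) (hsub false) ?_ ?_ (hac true) (hac false) h
  · intro f hf hf' g hg hg'
    have e1 : f = .inr (i, true) := by
      by_contra e; exact hf' (Finset.mem_erase.2 ⟨e, hf⟩)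
    have e2 : g = .inr (i, false) := by
      by_contra e; exact hg' (Finset.mem_erase.2 ⟨e, hg⟩)
    subst e1 e2
    intro h; exact absurd (h rfl) (by decide)
  · ext (k | ⟨j, c⟩)
    · simp [inl_LS]
    · simp only [Finset.mem_inter, Finset.mem_erase, inr_LS, Finset.mem_insert]
      by_cases hj : j = i
      · subst hj
        cases c <;> simp [hi]
      · simp [hj]

lemma cube_all {A : Finset (Fin 6)} (B : Finset (Fin (n - 2)))
    (hT : ∀ f ∈ LS A B, ω (chi f) ≠ 1) {k : ℕ}
    (h : SphD ω (XS (LS A (∅ : Finset (Fin (n - 2))))) k) :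
    SphD ω (XS (LS A B)) (k + B.card) := by
  induction B using Finset.induction_on with
  | empty => simpa using h
  | insert i B hi ih =>
    rw [Finset.card_insert_of_notMem hi, ← add_assoc]
    refine cube_susp i hi hT (ih fun f hf => hT f ?_)
    rcases f with k | ⟨j, c⟩
    · rw [inl_LS] at hf ⊢; exact hf
    · rw [inr_LS] at hf ⊢; exact Finset.mem_insert_of_mem hf

lemma sph_base : SphD ω (XS (LS (∅ : Finset (Fin 6)) (∅ : Finset (Fin (n - 2))))) 0 := by
  have h0 : LS (∅ : Finset (Fin 6)) (∅ : Finset (Fin (n - 2))) = ∅ := by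
    ext (k | ⟨i, b⟩) <;> simp [inl_LS, inr_LS]
  rw [h0]
  exact ⟨z0 ω, by rw [z0, pj_pr, pr_pt], sph_XS (by simp) (by simp)⟩

lemma acyH {A : Finset (Fin 6)} (hT : ∀ f ∈ LS A (∅ : Finset (Fin (n - 2))), ω (chi f) ≠ 1)
    (k : Fin 6) (hk : k ∈ A) (had : ∀ j ∈ A, adjH k j = true) :
    Acy ω (XS (LS A (∅ : Finset (Fin (n - 2))))) := by
  refine acy_cone hT (inl_LS.2 hk) ?_
  rintro (j | ⟨i, b⟩) hg
  · exact had j (inl_LS.1 hg)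
  · trivial

lemma hex_two {A : Finset (Fin 6)} (hT : ∀ f ∈ LS A (∅ : Finset (Fin (n - 2))), ω (chi f) ≠ 1)
    (A1 A2 : Finset (Fin 6)) (j k : Fin 6)
    (h : A1 ⊆ A ∧ A2 ⊆ A ∧ A1 ∩ A2 = ∅ ∧ (∀ j ∈ A, j ∉ A1 → ∀ k ∈ A, k ∉ A2 → ¬ adjH j k = true) ∧
      (j ∈ A1 ∧ ∀ i ∈ A1, adjH j i = true) ∧ (k ∈ A2 ∧ ∀ i ∈ A2, adjH k i = true)) :
    SphD ω (XS (LS A (∅ : Finset (Fin (n - 2))))) 1 := by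
  obtain ⟨h1, h2, h3, h4, h5, h6⟩ := h
  refine susp (T1 := LS A1 ∅) (T2 := LS A2 ∅) (T12 := LS ∅ ∅) (LS_mono h1) (LS_mono h2)
    (LS_sep h4) (by rw [LS_inter, h3])
    (acyH (fun f hf => hT f (LS_mono h1 hf)) j h5.1 h5.2)
    (acyH (fun f hf => hT f (LS_mono h2 hf)) k h6.1 h6.2) sph_base

lemma hex_path {A : Finset (Fin 6)} (hT : ∀ f ∈ LS A (∅ : Finset (Fin (n - 2))), ω (chi f) ≠ 1)
    (A1 A2 A12 : Finset (Fin 6)) (j k l : Fin 6)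
    (h : A1 ⊆ A ∧ A2 ⊆ A ∧ A1 ∩ A2 = A12 ∧
      (∀ j ∈ A, j ∉ A1 → ∀ k ∈ A, k ∉ A2 → ¬ adjH j k = true) ∧
      (j ∈ A1 ∧ ∀ i ∈ A1, adjH j i = true) ∧ (k ∈ A2 ∧ ∀ i ∈ A2, adjH k i = true) ∧
      (l ∈ A12 ∧ ∀ i ∈ A12, adjH l i = true)) :
    Acy ω (XS (LS A (∅ : Finset (Fin (n - 2))))) := by
  obtain ⟨h1, h2, h3, h4, h5, h6, h7⟩ := h
  refine acyU (T1 := LS A1 ∅) (T2 := LS A2 ∅) (T12 := LS A12 ∅) (LS_mono h1) (LS_mono h2)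
    (LS_sep h4) (by rw [LS_inter, h3])
    (acyH (fun f hf => hT f (LS_mono h1 hf)) j h5.1 h5.2)
    (acyH (fun f hf => hT f (LS_mono h2 hf)) k h6.1 h6.2)
    (acyH (fun f hf => hT f (LS_mono h1 (LS_mono (by rw [← h3]; exact Finset.inter_subset_left) hf)))
      l h7.1 h7.2)

lemma hex_all (hT : ∀ f ∈ LS Finset.univ (∅ : Finset (Fin (n - 2))), ω (chi f) ≠ 1) :
    SphD ω (XS (LS Finset.univ (∅ : Finset (Fin (n - 2))))) 2 := by
  refine susp (T1 := LS {5, 0, 1, 2, 3} ∅) (T2 := LS {2, 3, 4, 5, 0} ∅) (T12 := LS {5, 0, 2, 3} ∅)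
    (LS_mono (by decide)) (LS_mono (by decide)) (LS_sep (by decide)) (by rw [LS_inter]; congr 1) ?_ ?_ ?_
  · exact hex_path (fun f hf => hT f (LS_mono (by decide) hf)) {5, 0, 1} {1, 2, 3} {1} 0 2 1 ⟨by decide, by decide, by decide, by decide, ⟨by decide, by decide⟩, ⟨by decide, by decide⟩, ⟨by decide, by decide⟩⟩
  · exact hex_path (fun f hf => hT f (LS_mono (by decide) hf)) {2, 3, 4} {4, 5, 0} {4} 3 5 4 ⟨by decide, by decide, by decide, by decide, ⟨by decide, by decide⟩, ⟨by decide, by decide⟩, ⟨by decide, by decide⟩⟩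
  · exact hex_two (fun f hf => hT f (LS_mono (by decide) hf)) {5, 0} {2, 3} 0 2 ⟨by decide, by decide, by decide, by decide, ⟨by decide, by decide⟩, ⟨by decide, by decide⟩⟩

/-- pattern of edges -/
def pat (a b c : Bool) : Finset (Fin 6) :=
  Finset.univ.filter fun k => ![a, b, c, a, b, c] k = true

def hdeg : Bool → Bool → Bool → ℕ
  | false, false, false => 0
  | true, true, true => 2
  | _, _, _ => 1

lemma hex_sph (a b c : Bool) (hT : ∀ f ∈ LS (pat a b c) (∅ : Finset (Fin (n - 2))), ω (chi f) ≠ 1) :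
    SphD ω (XS (LS (pat a b c) (∅ : Finset (Fin (n - 2))))) (hdeg a b c) := by
  cases a <;> cases b <;> cases c
  · exact sph_base
  · exact hex_two hT {2} {5} 2 5 ⟨by decide, by decide, by decide, by decide, ⟨by decide, by decide⟩, ⟨by decide, by decide⟩⟩
  · exact hex_two hT {1} {4} 1 4 ⟨by decide, by decide, by decide, by decide, ⟨by decide, by decide⟩, ⟨by decide, by decide⟩⟩
  · exact hex_two hT {1, 2} {4, 5} 1 4 ⟨by decide, by decide, by decide, by decide, ⟨by decide, by decide⟩, ⟨by decide, by decide⟩⟩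
  · exact hex_two hT {0} {3} 0 3 ⟨by decide, by decide, by decide, by decide, ⟨by decide, by decide⟩, ⟨by decide, by decide⟩⟩
  · exact hex_two hT {2, 3} {5, 0} 2 5 ⟨by decide, by decide, by decide, by decide, ⟨by decide, by decide⟩, ⟨by decide, by decide⟩⟩
  · exact hex_two hT {0, 1} {3, 4} 0 3 ⟨by decide, by decide, by decide, by decide, ⟨by decide, by decide⟩, ⟨by decide, by decide⟩⟩
  · exact hex_all hT

open Classical in
theorem sph_cover (ω : AddChar (GG n) ℚ) :
    SphD ω (Set.univ : Set (HexCover n))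
      (hdeg (decide (ω (fun _ => 1) ≠ 1)) (decide (ω (eVec n (n - 2)) ≠ 1))
        (decide (ω (eVec n (n - 1)) ≠ 1)) +
        (Finset.univ.filter fun i : Fin (n - 2) => ω (eVec n i) ≠ 1).card) := by
  set a := decide (ω (fun _ => 1) ≠ 1) with ha
  set b := decide (ω (eVec n (n - 2)) ≠ 1) with hb
  set c := decide (ω (eVec n (n - 1)) ≠ 1) with hc
  set B := (Finset.univ.filter fun i : Fin (n - 2) => ω (eVec n i) ≠ 1) with hB
  have e : Lw ω = LS (pat a b c) B := by
    ext (k | ⟨i, s⟩)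
    · rw [mem_Lw, inl_LS, pat, Finset.mem_filter]
      fin_cases k <;> simp [chi, hexEdgeVal, ha, hb, hc]
    · rw [mem_Lw, inr_LS, hB]; simp [chi]
  have hT : ∀ f ∈ LS (pat a b c) B, ω (chi f) ≠ 1 := by
    intro f hf
    rw [← e, mem_Lw] at hf
    exact hf
  have h1 := cube_all B hT (hex_sph a b c fun f hf => hT f (by
    rcases f with k | ⟨i, s⟩
    · rw [inl_LS] at hf ⊢; exact hf
    · simp [inr_LS] at hf))
  rw [← e] at h1
  obtain ⟨z, hz, hs⟩ := h1
  exact ⟨z, hz, hs.of_rel dd_dd (FF_mono (Set.subset_univ _)) rel_Lw⟩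

end Comb
end HC

set_option linter.unusedSectionVars false
namespace HC

/-! ### Part 8: comparison with homology of chain complexes of modules -/
section Cmp

lemma sc_rank {M : Type*} [AddCommGroup M] [Module ℚ M] (D : M →ₗ[ℚ] M)
    (S : ShortComplex (ModuleCat.{0} ℚ)) (e1 : S.X₁ →ₗ[ℚ] M) (e2 : S.X₂ →ₗ[ℚ] M)
    (A1 A2 : Submodule ℚ M)
    (i2 : Function.Injective e2)
    (r1 : ∀ y, e1 y ∈ A1) (r1' : ∀ x ∈ A1, ∃ y, e1 y = x)
    (r2' : ∀ x ∈ A2, ∃ y, e2 y = x) (r2 : ∀ y, e2 y ∈ A2)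
    (hf : ∀ y, e2 (S.f.hom y) = D (e1 y)) (hg : ∀ y, S.g.hom y = 0 ↔ D (e2 y) = 0)
    {ι : Type} [Fintype ι] (z : ι → M) (hz : ∀ w, z w ∈ A2) (hdz : ∀ w, D (z w) = 0)
    (sp : ∀ x ∈ A2, D x = 0 → ∃ q : ι → ℚ, ∃ c ∈ A1, x = ∑ w, q w • z w + D c)
    (li : ∀ q : ι → ℚ, ∀ c ∈ A1, ∑ w, q w • z w = D c → q = 0) :
    Module.rank ℚ S.homology = (Fintype.card ι : ℕ) := by
  choose y hy using fun w => r2' (z w) (hz w)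
  let zt : ι → LinearMap.ker S.g.hom := fun w => ⟨y w, by
    rw [LinearMap.mem_ker, hg, hy, hdz]⟩
  let R := LinearMap.range S.moduleCatToCycles
  let φ : (ι → ℚ) →ₗ[ℚ] (LinearMap.ker S.g.hom ⧸ R) :=
    R.mkQ ∘ₗ Fintype.linearCombination ℚ zt
  have hφ : ∀ q, φ q = Submodule.Quotient.mk (∑ w, q w • zt w) := fun q => by
    rw [LinearMap.comp_apply, Fintype.linearCombination_apply]; rfl
  have hval : ∀ q : ι → ℚ, e2 ((∑ w, q w • zt w : LinearMap.ker S.g.hom) : S.X₂) = ∑ w, q w • z w := by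
    intro q
    simp [zt, hy]
  have bij : Function.Bijective φ := by
    constructor
    · rw [← LinearMap.ker_eq_bot, LinearMap.ker_eq_bot']
      intro q hq
      rw [hφ, Submodule.Quotient.mk_eq_zero] at hq
      obtain ⟨c, hc⟩ := hq
      refine li q (e1 c) (r1 c) ?_
      rw [← hval, ← hc, ← hf]
      rfl
    · intro x
      obtain ⟨⟨x, hx⟩, rfl⟩ := Submodule.Quotient.mk_surjective _ x
      rw [LinearMap.mem_ker, hg] at hx
      obtain ⟨q, c, hc, e⟩ := sp (e2 x) (r2 x) hx
      obtain ⟨c, rfl⟩ := r1' c hc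
      refine ⟨q, ?_⟩
      rw [hφ, eq_comm, Submodule.Quotient.eq]
      refine ⟨c, Subtype.ext (i2 ?_)⟩
      show e2 (S.f.hom c) = e2 (x - ((∑ w, q w • zt w : LinearMap.ker S.g.hom) : S.X₂))
      rw [hf, map_sub, hval, e]; abel
  have h1 : Module.rank ℚ S.homology = Module.rank ℚ (LinearMap.ker S.g.hom ⧸ R) :=
    LinearEquiv.rank_eq S.moduleCatHomologyIso.toLinearEquiv
  rw [h1, ← LinearEquiv.rank_eq (LinearEquiv.ofBijective φ bij), rank_fun']

variable {X : Type} [TopologicalSpace X]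

/-- chain complex of the statement -/
noncomputable abbrev KK (X : Type) [TopologicalSpace X] : ChainComplex (ModuleCat.{0} ℚ) ℕ :=
  (AlgebraicTopology.alternatingFaceMapComplex (ModuleCat.{0} ℚ)).obj
    (((SimplicialObject.whiskering _ _).obj (ModuleCat.free ℚ)).obj
      (TopCat.toSSet.obj (TopCat.of X)))

/-- simplices of Mathlib as our simplices -/
noncomputable def sx (k : ℕ) (s : (TopCat.toSSet.obj (TopCat.of X)).obj (.op (.mk k))) : Sing X :=
  ⟨k, TopCat.toSSetObjEquiv _ _ s⟩

noncomputable def em0 (k : ℕ) :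
    ((TopCat.toSSet.obj (TopCat.of X)).obj (.op (.mk k)) →₀ ℚ) →ₗ[ℚ] SC X :=
  Finsupp.lmapDomain ℚ ℚ (sx k)

noncomputable def em (k : ℕ) : (KK X).X k →ₗ[ℚ] SC X := em0 k

lemma sx_inj (k : ℕ) : Function.Injective (sx (X := X) k) := by
  intro s t h
  have := eq_of_heq (Sigma.mk.inj h).2
  exact (TopCat.toSSetObjEquiv _ _).injective this

lemma em_inj (k : ℕ) : Function.Injective (em (X := X) k) :=
  Finsupp.mapDomain_injective (sx_inj k)

lemma em0_single (k : ℕ) (s) : em0 (X := X) k (Finsupp.single s 1) = Finsupp.single (sx k s) 1 := by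
  simp [em0]

lemma em_pr (k : ℕ) (y) : pr k (em (X := X) k y) = em k y := by
  have : pr k ∘ₗ em0 (X := X) k = em0 k := by
    apply Finsupp.lhom_ext'
    intro s
    apply LinearMap.ext_ring
    simp only [LinearMap.comp_apply, Finsupp.lsingle_apply]
    rw [em0_single, pr_single]; exact if_pos rfl
  exact LinearMap.congr_fun this y

lemma em_surj (k : ℕ) (x : SC X) (hx : pr k x = x) : ∃ y, em k y = x := by
  have : ∀ x : SC X, pr k x ∈ LinearMap.range (em0 (X := X) k) := by
    intro x
    induction x using Finsupp.induction_linear with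
    | zero => simp
    | add f g hf hg => rw [map_add]; exact Submodule.add_mem _ hf hg
    | single s q =>
      rw [← mul_one q, ← smul_eq_mul, ← Finsupp.smul_single, map_smul]
      refine Submodule.smul_mem _ _ ?_
      rw [pr_single]
      split_ifs with h
      · obtain ⟨j, σ⟩ := s
        have h' : j = k := h
        subst h'
        refine ⟨Finsupp.single ((TopCat.toSSetObjEquiv _ _).symm σ) 1, ?_⟩
        rw [em0_single, sx, Equiv.apply_symm_apply]
      · exact Submodule.zero_mem _
  obtain ⟨y, hy⟩ := this x
  exact ⟨y, by rw [← hx]; exact hy⟩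

lemma alt_lem {M N : ModuleCat.{0} ℚ} {V : Type*} [AddCommGroup V] [Module ℚ V] {m : ℕ}
    (F : Fin m → (M ⟶ N)) (e : N →ₗ[ℚ] V) (x : M) :
    e ((∑ i : Fin m, (-1 : ℤ) ^ (i : ℕ) • F i).hom x) =
      ∑ i : Fin m, (-1 : ℚ) ^ (i : ℕ) • e ((F i).hom x) := by
  rw [ModuleCat.hom_sum, LinearMap.sum_apply, map_sum]
  refine Finset.sum_congr rfl fun i _ => ?_
  rw [ModuleCat.hom_zsmul, LinearMap.smul_apply, map_zsmul, ← Int.cast_smul_eq_zsmul ℚ]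
  simp only [Int.cast_pow, Int.cast_neg, Int.cast_one]

lemma em_d (k : ℕ) (y : (KK X).X (k + 1)) :
    em (X := X) k (((KK X).d (k + 1) k).hom y) = dd (em (k + 1) y) := by
  have : em (X := X) k ∘ₗ ((KK X).d (k + 1) k).hom = dd ∘ₗ em (k + 1) := by
    apply Finsupp.lhom_ext'
    intro s
    apply LinearMap.ext_ring
    rw [AlgebraicTopology.alternatingFaceMapComplex_obj_d]
    simp only [AlgebraicTopology.AlternatingFaceMapComplex.objD]
    have h1 : ∀ i : Fin (k + 2), (((((SimplicialObject.whiskering _ _).obj (ModuleCat.free ℚ)).obj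
      (TopCat.toSSet.obj (TopCat.of X))).δ i).hom (Finsupp.single s 1) : (KK X).X k) =
      (Finsupp.single ((TopCat.toSSet.obj (TopCat.of X)).δ i s) 1 : _ →₀ ℚ) := fun i =>
      Finsupp.mapDomain_single
    have h2 : ∀ i : Fin (k + 2), sx k ((TopCat.toSSet.obj (TopCat.of X)).δ i s) =
      ⟨k, (sx (k + 1) s).2.comp (face i)⟩ := fun i => rfl
    have h3 : dd (em0 (X := X) (k + 1) (Finsupp.single s 1)) = ∑ i : Fin (k + 2),
        (-1 : ℚ) ^ (i : ℕ) • em0 (X := X) k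
          (Finsupp.single ((TopCat.toSSet.obj (TopCat.of X)).δ i s) 1) := by
      rw [em0_single, dd, extS_single]
      show ∑ i : Fin (k + 2), _ = _
      refine Finset.sum_congr rfl fun i _ => ?_
      rw [em0_single, h2]; rfl
    refine Eq.trans ?_ h3.symm
    refine (alt_lem (fun i => (((SimplicialObject.whiskering _ _).obj (ModuleCat.free ℚ)).obj
      (TopCat.toSSet.obj (TopCat.of X))).δ i) (em (X := X) k) (Finsupp.single s 1 : _ →₀ ℚ)).trans ?_
    refine Finset.sum_congr rfl fun i _ => ?_
    rw [h1]
    rfl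
  exact LinearMap.congr_fun this y

lemma cc_rank (K : ChainComplex (ModuleCat.{0} ℚ) ℕ) (ee : ∀ k, K.X k →ₗ[ℚ] SC X)
    (ee_inj : ∀ k, Function.Injective (ee k)) (ee_pr : ∀ k y, pr k (ee k y) = ee k y)
    (ee_surj : ∀ k (x : SC X), pr k x = x → ∃ y, ee k y = x)
    (ee_d : ∀ k (y : K.X (k + 1)), ee k ((K.d (k + 1) k).hom y) = dd (ee (k + 1) y))
    (i : ℕ) {ι : Type} [Fintype ι] (z : ι → SC X) (hz : ∀ w, pr i (z w) = z w)
    (hdz : ∀ w, dd (z w) = 0)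
    (sp : ∀ x, pr i x = x → dd x = 0 → ∃ q : ι → ℚ, ∃ c, x = ∑ w, q w • z w + dd c)
    (li : ∀ q : ι → ℚ, ∀ c, ∑ w, q w • z w = dd c → q = 0) :
    Module.rank ℚ (K.homology i) = (Fintype.card ι : ℕ) := by
  have hn : ∃ j, (ComplexShape.down ℕ).next i = j ∧
      ∀ y : K.X i, (K.d i j).hom y = 0 ↔ dd (ee i y) = 0 := by
    rcases i with _ | i
    · refine ⟨0, ChainComplex.next_nat_zero, fun y => ?_⟩
      rw [K.shape 0 0 (by simp)]
      refine iff_of_true rfl ?_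
      rw [← ee_pr, pr_zero_dd]
    · refine ⟨i, ChainComplex.next_nat_succ i, fun y => ?_⟩
      rw [← ee_d]
      exact ⟨fun h => by rw [h, map_zero], fun h => ee_inj i (by rw [h, map_zero])⟩
  obtain ⟨j, hj, hg⟩ := hn
  have hp : (ComplexShape.down ℕ).prev i = i + 1 := ChainComplex.prev ℕ i
  have e : Module.rank ℚ (K.homology i) =
      Module.rank ℚ (K.sc' (i + 1) i j).homology :=
    LinearEquiv.rank_eq (K.homologyIsoSc' (i + 1) i j hp hj).toLinearEquiv
  rw [e]
  have pm : ∀ k (x : SC X), x ∈ LinearMap.ker (pr k - LinearMap.id : SC X →ₗ[ℚ] SC X) ↔ pr k x = x := by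
    intro k x
    rw [LinearMap.mem_ker, LinearMap.sub_apply, LinearMap.id_apply, sub_eq_zero]
  refine sc_rank dd (K.sc' (i + 1) i j) (ee (i + 1)) (ee i) (LinearMap.ker (pr (i + 1) - LinearMap.id))
    (LinearMap.ker (pr i - LinearMap.id)) (ee_inj i) (fun y => (pm _ _).2 (ee_pr _ _))
    (fun x hx => ee_surj _ x ((pm _ _).1 hx)) (fun x hx => ee_surj _ x ((pm _ _).1 hx))
    (fun y => (pm _ _).2 (ee_pr _ _)) (fun y => ee_d i y) hg z (fun w => (pm _ _).2 (hz w)) hdz ?_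
    (fun q c _ => li q c)
  intro x hx hdx
  rw [pm] at hx
  obtain ⟨q, c, h⟩ := sp x hx hdx
  refine ⟨q, pr (i + 1) c, (pm _ _).2 (pr_pr _ _), ?_⟩
  rw [pr_dd]
  have := congrArg (pr i) h
  rw [hx, map_add, map_sum] at this
  simpa only [map_smul, hz] using this

theorem betti_eq (i : ℕ) {ι : Type} [Fintype ι] (z : ι → SC X) (hz : ∀ w, pr i (z w) = z w)
    (hdz : ∀ w, dd (z w) = 0)
    (sp : ∀ x, pr i x = x → dd x = 0 → ∃ q : ι → ℚ, ∃ c, x = ∑ w, q w • z w + dd c)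
    (li : ∀ q : ι → ℚ, ∀ c, ∑ w, q w • z w = dd c → q = 0) :
    rationalBetti (TopCat.of X) i = (Fintype.card ι : ℕ) :=
  cc_rank (KK X) em em_inj em_pr em_surj em_d i z hz hdz sp li

end Cmp
end HC

set_option linter.unusedSectionVars false
namespace HC

/-! ### Part 9: characters, decomposition and counting -/
section Fin

/-- sign -/
def sg (a : ZMod 2) : ℚ := if a = 0 then 1 else -1

lemma sg_add (a b : ZMod 2) : sg (a + b) = sg a * sg b := by
  have : ∀ a : ZMod 2, a = 0 ∨ a = 1 := by decide
  rcases this a with rfl | rfl <;> rcases this b with rfl | rfl <;>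
    simp [sg, show (1 + 1 : ZMod 2) = 0 from rfl]

abbrev WW (m : ℕ) : Type := Finset (Fin m) × Bool × Bool

variable {m : ℕ}

def chv (w : WW m) (g : GG (m + 2)) : ℚ :=
  (∏ i ∈ w.1, sg (g i.castSucc.castSucc)) * (if w.2.1 then sg (g (Fin.last m).castSucc) else 1) *
    (if w.2.2 then sg (g (Fin.last (m + 1))) else 1)

def ch (w : WW m) : AddChar (GG (m + 2)) ℚ where
  toFun := chv w
  map_zero_eq_one' := by simp [chv, sg]
  map_add_eq_mul' g h := by
    simp only [chv, Pi.add_apply, sg_add, Finset.prod_mul_distrib]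
    split_ifs <;> ring

lemma ch_apply (w : WW m) (g : GG (m + 2)) : ch w g = chv w g := rfl

lemma sg_sum (g : GG (m + 2)) : ∑ w : WW m, ch w g = if g = 0 then (2 : ℚ) ^ (m + 2) else 0 := by
  have h1 : ∑ w : WW m, ch w g = (∏ i : Fin m, (1 + sg (g i.castSucc.castSucc))) *
      (1 + sg (g (Fin.last m).castSucc)) * (1 + sg (g (Fin.last (m + 1)))) := by
    rw [Finset.prod_one_add]
    rw [Fintype.sum_prod_type, Finset.powerset_univ, mul_assoc, Finset.sum_mul]
    refine Finset.sum_congr rfl fun A _ => ?_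
    rw [Fintype.sum_prod_type]
    simp [ch_apply, chv]
    ring
  rw [h1]
  split_ifs with h
  · subst h
    norm_num [sg, pow_succ, mul_assoc]
  · obtain ⟨i, hi⟩ : ∃ i, g i ≠ 0 := by
      by_contra hc; push Not at hc; exact h (funext hc)
    induction i using Fin.lastCases with
    | last => simp [sg, hi]
    | cast i =>
      induction i using Fin.lastCases with
      | last => simp [sg, hi]
      | cast i =>
        rw [Finset.prod_eq_zero (Finset.mem_univ i) (by simp [sg, hi])]; simp

lemma sum_pj (x : SC (HexCover (m + 2))) : ∑ w : WW m, pj (ch w) x = x := by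
  simp only [pj_apply]
  rw [← Finset.smul_sum, Finset.sum_comm]
  simp only [← Finset.sum_smul, sg_sum]
  rw [Finset.sum_eq_single 0 (fun g _ hg => by simp [hg]) (by simp)]
  have h0 : ac (0 : GG (m + 2)) x = x := by
    refine sc_ext (f := ac (0 : GG (m + 2))) (g := LinearMap.id) ?_ x
    intro s
    rw [ac, pu_single, LinearMap.id_apply]
    congr 1
    refine Sigma.ext rfl (heq_of_eq ?_)
    ext y
    exact zero_vadd (GG (m + 2)) (s.2 y)
  simp [h0, smul_smul]

lemma ev_ne {a b : ℕ} {n : ℕ} (i : Fin n) (h : (i : ℕ) = a) : eVec n b i = if a = b then 1 else 0 := by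
  simp [eVec, h]

lemma ch_cube (w : WW m) (i : Fin m) : ch w (eVec (m + 2) i) = if i ∈ w.1 then -1 else 1 := by
  rw [ch_apply, chv]
  have h1 : ∀ j : Fin m, sg (eVec (m + 2) i j.castSucc.castSucc) = if j = i then -1 else 1 := by
    intro j
    by_cases h : j = i <;> simp [eVec, sg, h, Fin.val_inj]
  have h2 : (m : ℕ) ≠ i := by omega
  have h3 : (m + 1 : ℕ) ≠ i := by omega
  simp only [h1]
  simp [eVec, sg, h2, h3]

lemma ch_b (w : WW m) : ch w (eVec (m + 2) m) = if w.2.1 then -1 else 1 := by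
  rw [ch_apply, chv]
  have h1 : ∀ j : Fin m, sg (eVec (m + 2) m j.castSucc.castSucc) = 1 := by
    intro j
    have : (j : ℕ) ≠ m := by omega
    simp [eVec, sg, this]
  simp only [h1]
  simp [eVec, sg]

lemma ch_c (w : WW m) : ch w (eVec (m + 2) (m + 1)) = if w.2.2 then -1 else 1 := by
  rw [ch_apply, chv]
  have h1 : ∀ j : Fin m, sg (eVec (m + 2) (m + 1) j.castSucc.castSucc) = 1 := by
    intro j
    have : (j : ℕ) ≠ m + 1 := by omega
    simp [eVec, sg, this]
  simp only [h1]
  simp [eVec, sg]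

lemma ch_one (w : WW m) : ch w (fun _ => 1) =
    (-1) ^ w.1.card * (if w.2.1 then -1 else 1) * (if w.2.2 then -1 else 1) := by
  rw [ch_apply, chv]
  simp [sg]

lemma ch_inj {v w : WW m} (h : ch v = ch w) : v = w := by
  obtain ⟨A, b, c⟩ := v
  obtain ⟨A', b', c'⟩ := w
  have h1 := fun i : Fin m => congrArg (fun f : AddChar (GG (m + 2)) ℚ => f (eVec (m + 2) i)) h
  have h2 := congrArg (fun f : AddChar (GG (m + 2)) ℚ => f (eVec (m + 2) m)) h
  have h3 := congrArg (fun f : AddChar (GG (m + 2)) ℚ => f (eVec (m + 2) (m + 1))) h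
  simp only [ch_cube, ch_b, ch_c] at h1 h2 h3
  have e1 : A = A' := by
    ext i
    have := h1 i
    by_cases ha : i ∈ A <;> by_cases hb : i ∈ A' <;> simp [ha, hb] at this ⊢ <;> norm_num at this
  have e2 : b = b' := by
    cases b <;> cases b' <;> simp at h2 ⊢ <;> norm_num at h2
  have e3 : c = c' := by
    cases c <;> cases c' <;> simp at h3 ⊢ <;> norm_num at h3
  rw [e1, e2, e3]

/-- the degree -/
def kk (w : WW m) : ℕ :=
  (match w.2 with
    | (false, false) => if Even w.1.card then 0 else 1
    | (true, true) => if Even w.1.card then 1 else 2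
    | _ => 1) + w.1.card

lemma sph_ch (w : WW m) : SphD (ch w) (Set.univ : Set (HexCover (m + 2))) (kk w) := by
  classical
  have h := sph_cover (ch w)
  have e1 : (Finset.univ.filter fun i : Fin (m + 2 - 2) => ch w (eVec (m + 2) i) ≠ 1).card = w.1.card := by
    congr 1
    ext i
    rw [Finset.mem_filter]
    have := ch_cube w i
    rw [this]
    by_cases hi : (show Fin m from i) ∈ w.1
    · simp [hi]; norm_num
    · simp [hi]
  have e2 : ch w (eVec (m + 2) (m + 2 - 2)) = _ := ch_b w
  have e3 : ch w (eVec (m + 2) (m + 2 - 1)) = _ := ch_c w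
  rw [e1, e2, e3, ch_one] at h
  convert h using 1
  rw [kk]
  congr 1
  obtain ⟨A, b, c⟩ := w
  have hn : (-1 : ℚ) ≠ 1 := by norm_num
  rcases Nat.even_or_odd A.card with hA | hA
  · cases b <;> cases c <;> simp [hdeg, hA, hA.neg_one_pow, hn]
  · have hA' := Nat.not_even_iff_odd.2 hA
    cases b <;> cases c <;> simp [hdeg, hA', hA.neg_one_pow, hn]

lemma pj_zero {v w : WW m} (h : v ≠ w) {a : SC (HexCover (m + 2))} (ha : a ∈ FF (ch w) Set.univ) :
    pj (ch v) a = 0 := by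
  obtain ⟨g, hg⟩ : ∃ g, ch v g ≠ ch w g := by
    by_contra hc; push Not at hc; exact h (ch_inj (DFunLike.ext _ _ hc))
  have h1 := pj_ac (ω := ch v) g a
  rw [ha.2, map_smul, ← sub_eq_zero, ← sub_smul, smul_eq_zero] at h1
  exact h1.resolve_left (sub_ne_zero.2 (Ne.symm hg))

lemma CU_univ (a : SC (HexCover (m + 2))) : a ∈ CU (Set.univ : Set (HexCover (m + 2))) :=
  fun _ _ _ => trivial

theorem betti_count (i : ℕ) : rationalBetti (TopCat.of (HexCover (m + 2))) i =
    (Fintype.card {w : WW m // kk w = i} : ℕ) := by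
  choose z hz hs using fun w : WW m => sph_ch w
  have huniv : Inv (GG (m + 2)) (Set.univ : Set (HexCover (m + 2))) := fun _ _ _ => trivial
  refine betti_eq i (fun w : {w : WW m // kk w = i} => z w.1) (fun w => by
    have := hz w.1; rwa [w.2] at this) (fun w => (hs w.1).2.1) ?_ ?_
  · intro x hx hdx
    have h1 : ∀ w : WW m, ∃ q : ℚ, ∃ c, pj (ch w) x = q • z w + dd c := by
      intro w
      obtain ⟨q, c, _, h⟩ := (hs w).2.2.1 _ (pj_mem huniv (CU_univ x)) (by rw [pj_dd, hdx, map_zero])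
      exact ⟨q, c, h⟩
    choose q c hq using h1
    have h2 : ∀ w, pj (ch w) x = (if kk w = i then q w • z w else 0) + dd (pr (i + 1) (c w)) := by
      intro w
      rw [pr_dd]
      have := congrArg (pr i) (hq w)
      rw [pj_pr, hx, map_add, map_smul] at this
      rw [this]
      congr 1
      split_ifs with h
      · have := hz w
        rw [h] at this; rw [this]
      · rw [← hz w, pr_pr_ne (Ne.symm h), smul_zero]
    refine ⟨fun w => q w.1, ∑ w, pr (i + 1) (c w), ?_⟩
    conv_lhs => rw [← sum_pj x]
    simp only [h2]
    rw [Finset.sum_add_distrib, map_sum, ← Finset.sum_filter]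
    congr 1
    exact Finset.sum_subtype _ (by simp) _
  · intro q c h
    funext v
    have h1 := congrArg (pj (ch v.1)) h
    rw [map_sum, Finset.sum_eq_single v, map_smul, pj_eq (hs v.1).1, ← pj_dd] at h1
    · exact (hs v.1).2.2.2 _ _ (pj_mem huniv (CU_univ c)) h1
    · intro w _ hw
      rw [map_smul, pj_zero (fun e => hw (Subtype.ext e.symm)) (hs w.1).1, smul_zero]
    · simp

lemma card_len (j : ℕ) : ∑ A : Finset (Fin m), (if A.card = j then 1 else 0) = m.choose j := by
  rw [← Finset.card_filter]
  have := Fintype.card_finset_len (α := Fin m) j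
  rw [Fintype.card_fin] at this
  rw [← this, Fintype.card_subtype]

lemma card_len1 (i : ℕ) : ∑ A : Finset (Fin m), (if A.card + 1 = i then 1 else 0) =
    chooseInt m ((i : ℤ) - 1) := by
  rcases i with _ | i
  · simp [chooseInt]
  · simp only [Nat.add_right_cancel_iff, card_len]
    simp [chooseInt]

lemma card_len2 (i : ℕ) : ∑ A : Finset (Fin m), (if A.card + 2 = i then 1 else 0) =
    chooseInt m ((i : ℤ) - 2) := by
  rcases i with _ | _ | i
  · simp [chooseInt]
  · simp [chooseInt]
  · have : ((i + 1 + 1 : ℕ) : ℤ) - 2 = i := by push_cast; ring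
    rw [this]
    simp only [add_assoc, Nat.reduceAdd, Nat.add_right_cancel_iff, card_len]
    simp [chooseInt]

lemma kk_sum (i : ℕ) (A : Finset (Fin m)) :
    ∑ b : Bool × Bool, (if kk (A, b) = i then 1 else 0) =
      3 * (if A.card + 1 = i then 1 else 0) +
        (if Even i then (if A.card = i then 1 else 0) else (if A.card + 2 = i then 1 else 0)) := by
  rw [Fintype.sum_prod_type]
  simp only [Fintype.sum_bool, kk]
  rcases Nat.even_or_odd A.card with hA | hA
  · simp only [hA, if_true, zero_add, add_comm 1]
    rw [Nat.even_iff] at hA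
    simp only [Nat.even_iff]
    split_ifs <;> omega
  · simp only [Nat.not_even_iff_odd.2 hA, if_false, add_comm 1, add_comm 2]
    rw [Nat.odd_iff] at hA
    simp only [Nat.even_iff]
    split_ifs <;> omega

lemma count (i : ℕ) : Fintype.card {w : WW m // kk w = i} =
    if Even i then 3 * chooseInt m ((i : ℤ) - 1) + m.choose i
      else 3 * chooseInt m ((i : ℤ) - 1) + chooseInt m ((i : ℤ) - 2) := by
  rw [Fintype.card_subtype, Finset.card_filter, Fintype.sum_prod_type]
  simp only [kk_sum]
  rw [Finset.sum_add_distrib, ← Finset.mul_sum, card_len1]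
  split_ifs
  · rw [card_len]
  · rw [card_len2]

end Fin
end HC

/-- For `n ≥ 3` and `0 ≤ i ≤ n`, the `i`-th rational Betti number of the
small cover `X(P₆ × I^{n−2}, χ'')` is `3·C(n−2, i−1) + C(n−2, i)` if `i` is even and
`3·C(n−2, i−1) + C(n−2, i−2)` if `i` is odd. -/
theorem rationalBetti_hexCover (n i : ℕ) (hn : 3 ≤ n) (hi : i ≤ n) :
    rationalBetti (TopCat.of (HexCover n)) i =
      if Even i then
        ((3 * chooseInt (n - 2) ((i : ℤ) - 1) + (n - 2).choose i : ℕ) : Cardinal)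
      else
        ((3 * chooseInt (n - 2) ((i : ℤ) - 1) + chooseInt (n - 2) ((i : ℤ) - 2) : ℕ) :
          Cardinal) := by
  obtain ⟨m, rfl⟩ : ∃ m, n = m + 2 := ⟨n - 2, by omega⟩
  rw [HC.betti_count, HC.count, Nat.add_sub_cancel]
  split_ifs <;> rfl
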